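/- arXiv:1308.2324 — 13 statements merged into one kernel-verified Lean document; each statement's English description precedes it below -/
import Mathlib

section
/- Let ā > 0 satisfy P(ρ = ā) = 0, and set X̄ = x_d·1_{ρ>ā} + x_u·1_{ρ<ā}. Assume the capital constraint E[ρ·X̄] = x_r holds. Then every measurable random variable X with x_d ≤ X ≤ x_u almost surely and E[ρ·X] = x_r satisfies E[X] ≤ E[X̄]. (That is, the binary 'Bar-System' attains the highest expected return among all portfolios with initial capital x_r that are bounded between x_d and x_u.) -/
open MeasureTheory

/-- The binary `Bar-System` `X̄ = x_d·1_{ρ>ā} + x_u·1_{ρ<ā}` attains the highest expected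
return among all portfolios with initial capital `x_r` bounded between `x_d` and `x_u`. -/
theorem bar_system_maximizes_expected_return
    {Ω : Type*} [MeasurableSpace Ω] (P : Measure Ω) [IsProbabilityMeasure P]
    (ρ : Ω → ℝ) (hρm : Measurable ρ) (hρpos : ∀ ω, 0 < ρ ω)
    (hρint : Integrable ρ P) (hρ1 : ∫ ω, ρ ω ∂P = 1)
    (x_d x_r x_u : ℝ) (hdr : x_d < x_r) (hru : x_r < x_u)
    (abar : ℝ) (habar : 0 < abar) (hnull : P {ω | ρ ω = abar} = 0)
    (Xbar : Ω → ℝ)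
    (hXbar : Xbar = fun ω => if abar < ρ ω then x_d else if ρ ω < abar then x_u else 0)
    (hcap : ∫ ω, ρ ω * Xbar ω ∂P = x_r) :
    ∀ X : Ω → ℝ, Measurable X → (∀ᵐ ω ∂P, x_d ≤ X ω ∧ X ω ≤ x_u) →
      (∫ ω, ρ ω * X ω ∂P = x_r) → ∫ ω, X ω ∂P ≤ ∫ ω, Xbar ω ∂P := by
  intro X hX hb hXcap
  have hXbarm : Measurable Xbar := by
    rw [hXbar]
    exact Measurable.ite (measurableSet_lt measurable_const hρm) measurable_const
      (Measurable.ite (measurableSet_lt hρm measurable_const) measurable_const measurable_const)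
  have hXbound : ∀ᵐ ω ∂P, ‖X ω‖ ≤ |x_d| + |x_u| := by
    filter_upwards [hb] with ω hω
    rw [Real.norm_eq_abs, abs_le]
    constructor <;>
      linarith [neg_abs_le x_d, le_abs_self x_u, abs_nonneg x_u, abs_nonneg x_d]
  have hXbarbound : ∀ᵐ ω ∂P, ‖Xbar ω‖ ≤ |x_d| + |x_u| := by
    refine Filter.Eventually.of_forall fun ω => ?_
    simp only [hXbar, Real.norm_eq_abs]
    split_ifs <;> simp [add_nonneg]
  have hXint : Integrable X P := Integrable.of_bound hX.aestronglyMeasurable _ hXbound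
  have hXbarint : Integrable Xbar P := Integrable.of_bound hXbarm.aestronglyMeasurable _ hXbarbound
  have hρX : Integrable (fun ω => ρ ω * X ω) P :=
    hρint.mul_bdd hX.aestronglyMeasurable hXbound
  have hρXbar : Integrable (fun ω => ρ ω * Xbar ω) P :=
    hρint.mul_bdd hXbarm.aestronglyMeasurable hXbarbound
  have hne : ∀ᵐ ω ∂P, ρ ω ≠ abar := by
    rw [ae_iff]
    simpa using hnull
  have hle : ∫ ω, (abar * X ω - ρ ω * X ω) ∂P ≤ ∫ ω, (abar * Xbar ω - ρ ω * Xbar ω) ∂P := by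
    refine integral_mono_ae ((hXint.const_mul abar).sub hρX)
      ((hXbarint.const_mul abar).sub hρXbar) ?_
    filter_upwards [hb, hne] with ω hω hneω
    simp only [hXbar]
    rcases lt_or_gt_of_ne hneω with h | h
    · rw [if_neg h.not_gt, if_pos h]
      nlinarith [mul_nonneg (sub_nonneg.2 h.le) (sub_nonneg.2 hω.2)]
    · rw [if_pos h]
      nlinarith [mul_nonneg (sub_nonneg.2 (le_of_lt h)) (sub_nonneg.2 hω.1)]
  rw [integral_sub (hXint.const_mul abar) hρX, integral_sub (hXbarint.const_mul abar) hρXbar,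
    integral_const_mul, integral_const_mul, hXcap, hcap] at hle
  exact le_of_mul_le_mul_left (by linarith) habar
end

section
/- Let x_d ≤ x₁ < x₂ ≤ x_r and 0 < b₂ < b₁, and define the two-line configurations X₁ = x₁·1_{ρ≥b₁} + x_u·1_{ρ<b₁} and X₂ = x₂·1_{ρ≥b₂} + x_u·1_{ρ<b₂}. If both satisfy the capital constraint E[ρ·X₁] = x_r and E[ρ·X₂] = x_r, then E[X₁] > E[X₂]. (The expected return of capital-feasible two-line configurations of this form strictly decreases as the lower level x increases from x_d to x_r.) -/
open MeasureTheory

/-- A two-line configuration is integrable, and so is its product with the integrable density. -/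
theorem integrable_two_line {Ω : Type*} [MeasurableSpace Ω] (P : Measure Ω) [IsFiniteMeasure P]
    (ρ : Ω → ℝ) (hρm : Measurable ρ) (hρint : Integrable ρ P) (u x b : ℝ) :
    Integrable (fun ω => if ρ ω < b then u else x) P ∧
      Integrable (fun ω => ρ ω * (if ρ ω < b then u else x)) P := by
  have hm : Measurable (fun ω => if ρ ω < b then u else x) :=
    Measurable.ite (measurableSet_lt hρm measurable_const) measurable_const measurable_const
  have hbd : ∀ ω, ‖if ρ ω < b then u else x‖ ≤ |u| + |x| := by
    intro ω
    have h1 := abs_nonneg u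
    have h2 := abs_nonneg x
    rw [Real.norm_eq_abs]
    split_ifs <;> linarith
  exact ⟨Integrable.of_bound hm.aestronglyMeasurable _ (Filter.Eventually.of_forall hbd),
    hρint.mul_bdd hm.aestronglyMeasurable (Filter.Eventually.of_forall hbd)⟩

/-- The expected return of capital-feasible two-line configurations
`X = x·1_{ρ≥b} + x_u·1_{ρ<b}` strictly decreases as the lower level `x`
increases from `x_d` to `x_r`. -/
theorem two_line_return_decreases_in_lower_level
    {Ω : Type*} [MeasurableSpace Ω] (P : Measure Ω) [IsProbabilityMeasure P]
    (ρ : Ω → ℝ) (hρm : Measurable ρ) (hρpos : ∀ ω, 0 < ρ ω)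
    (hρint : Integrable ρ P) (hρ1 : ∫ ω, ρ ω ∂P = 1)
    (x_d x_r x_u : ℝ) (hdr : x_d < x_r) (hru : x_r < x_u)
    (x₁ x₂ b₁ b₂ : ℝ) (hd1 : x_d ≤ x₁) (h12 : x₁ < x₂) (h2r : x₂ ≤ x_r)
    (hb2 : 0 < b₂) (hb21 : b₂ < b₁)
    (X₁ X₂ : Ω → ℝ)
    (hX₁ : X₁ = fun ω => if ρ ω < b₁ then x_u else x₁)
    (hX₂ : X₂ = fun ω => if ρ ω < b₂ then x_u else x₂)
    (hcap₁ : ∫ ω, ρ ω * X₁ ω ∂P = x_r)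
    (hcap₂ : ∫ ω, ρ ω * X₂ ω ∂P = x_r) :
    ∫ ω, X₂ ω ∂P < ∫ ω, X₁ ω ∂P := by
  obtain ⟨hi₁, hρi₁⟩ := integrable_two_line P ρ hρm hρint x_u x₁ b₁
  obtain ⟨hi₂, hρi₂⟩ := integrable_two_line P ρ hρm hρint x_u x₂ b₂
  rw [← hX₁] at hi₁
  rw [← hX₂] at hi₂
  replace hρi₁ : Integrable (fun ω => ρ ω * X₁ ω) P := by rwa [hX₁]
  replace hρi₂ : Integrable (fun ω => ρ ω * X₂ ω) P := by rwa [hX₂]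
  by_contra! hle
  have hD : ∫ ω, (X₁ ω - X₂ ω) ∂P ≤ 0 := by
    rw [integral_sub hi₁ hi₂]
    linarith
  have hρD : ∫ ω, (ρ ω * X₂ ω - ρ ω * X₁ ω) ∂P = 0 := by
    rw [integral_sub hρi₂ hρi₁, hcap₁, hcap₂, sub_self]
  have hDi : Integrable (fun ω => b₁ * (X₁ ω - X₂ ω)) P := (hi₁.sub hi₂).const_mul b₁
  have hρDi : Integrable (fun ω => ρ ω * X₂ ω - ρ ω * X₁ ω) P := hρi₂.sub hρi₁
  have hFi : Integrable
      (fun ω => b₁ * (X₁ ω - X₂ ω) + (ρ ω * X₂ ω - ρ ω * X₁ ω)) P :=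
    hDi.add hρDi
  have hF0 : ∀ ω, 0 ≤ b₁ * (X₁ ω - X₂ ω) + (ρ ω * X₂ ω - ρ ω * X₁ ω) := by
    intro ω
    rw [hX₁, hX₂]
    dsimp only
    split_ifs <;> nlinarith
  have hFint : ∫ ω, (b₁ * (X₁ ω - X₂ ω) + (ρ ω * X₂ ω - ρ ω * X₁ ω)) ∂P = 0 := by
    refine le_antisymm ?_ (integral_nonneg hF0)
    rw [integral_add hDi hρDi, integral_const_mul, hρD]
    nlinarith
  have hFae := (integral_eq_zero_iff_of_nonneg hF0 hFi).1 hFint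
  have hG0 : 0 ≤ᵐ[P] fun ω => ρ ω * X₂ ω - ρ ω * X₁ ω := by
    filter_upwards [hFae] with ω hω
    have hp := hρpos ω
    simp only [hX₁, hX₂, Pi.zero_apply] at hω ⊢
    split_ifs at hω ⊢ <;> nlinarith
  have hGae := (integral_eq_zero_iff_of_nonneg_ae hG0 hρDi).1 hρD
  have hcap : (fun ω => ρ ω * X₂ ω) =ᵐ[P] fun ω => ρ ω * x_u := by
    filter_upwards [hFae, hGae] with ω hω hω'
    have hp := hρpos ω
    simp only [hX₁, hX₂, Pi.zero_apply] at hω hω' ⊢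
    split_ifs at hω hω' ⊢ <;> nlinarith
  rw [integral_congr_ae hcap, integral_mul_const, hρ1] at hcap₂
  linarith
end

section
/- Let λ ∈ (0,1), let a* > 0, set A* = {ρ > a*} and B* = {ρ ≤ a*}, and assume P(A*) ≤ λ and P̃(A*) < 1. Define x* = (x_r − x_d·P̃(A*))/(1 − P̃(A*)) and assume x_d < x*. Then the 'Star-System' X* = x_d·1_{A*} + x*·1_{B*} satisfies E[ρ·X*] = x_r and CVaR_λ(X*) = −x_r + (1/λ)·(x* − x_d)·(P(A*) − λ·P̃(A*)). -/
open MeasureTheory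

/-- Conditional Value-at-Risk at level `l` of a random variable `X` under `P`:
`CVaR_l(X) = (1/l) · inf_t ( E[(t − X)⁺] − l·t )`. -/
noncomputable def cvar {Ω : Type*} [MeasurableSpace Ω] (P : Measure Ω) (l : ℝ)
    (X : Ω → ℝ) : ℝ :=
  (1 / l) * ⨅ t : ℝ, ((∫ ω, max (t - X ω) 0 ∂P) - l * t)

theorem integral_ite_const {Ω : Type*} [MeasurableSpace Ω] (P : Measure Ω)
    [IsProbabilityMeasure P] {s : Set Ω} [DecidablePred (· ∈ s)] (hs : MeasurableSet s)
    (a b : ℝ) : ∫ ω, (if ω ∈ s then a else b) ∂P = P.real s * a + (1 - P.real s) * b := by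
  have h : (fun ω => if ω ∈ s then a else b) = fun ω => s.indicator (fun _ => a - b) ω + b := by
    funext ω
    by_cases hω : ω ∈ s <;> simp [hω]
  rw [h, integral_add ((integrable_const _).indicator hs) (integrable_const _),
    integral_indicator_const _ hs]
  simp only [smul_eq_mul, integral_const, probReal_univ]
  ring

/-- CVaR of a two-valued random variable whose lower value has probability at most the level. -/
theorem cvar_ite_const {Ω : Type*} [MeasurableSpace Ω] (P : Measure Ω)
    [IsProbabilityMeasure P] {s : Set Ω} [DecidablePred (· ∈ s)] (hs : MeasurableSet s)
    {l a b : ℝ} (hl0 : 0 < l) (hl1 : l ≤ 1) (hsl : P.real s ≤ l) (hab : a ≤ b) :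
    cvar P l (fun ω => if ω ∈ s then a else b) = 1 / l * (P.real s * (b - a)) - b := by
  have hp : 0 ≤ P.real s := measureReal_nonneg
  have hint (t : ℝ) : ∫ ω, max (t - if ω ∈ s then a else b) 0 ∂P =
      P.real s * max (t - a) 0 + (1 - P.real s) * max (t - b) 0 := by
    rw [← integral_ite_const P hs]
    congr 1 with ω
    split_ifs <;> rfl
  have hmin : IsLeast (Set.range fun t : ℝ =>
      P.real s * max (t - a) 0 + (1 - P.real s) * max (t - b) 0 - l * t)
      (P.real s * (b - a) - l * b) := by
    refine ⟨⟨b, by simp [hab]⟩, ?_⟩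
    rintro _ ⟨t, rfl⟩
    dsimp only
    rcases le_total t b with htb | htb
    · rw [max_eq_right (sub_nonpos.2 htb)]
      nlinarith [mul_le_mul_of_nonneg_left (le_max_left (t - a) 0) hp,
        mul_nonneg (sub_nonneg.2 hsl) (sub_nonneg.2 htb)]
    · rw [max_eq_left (sub_nonneg.2 htb), max_eq_left (sub_nonneg.2 (hab.trans htb))]
      nlinarith [mul_nonneg (sub_nonneg.2 hl1) (sub_nonneg.2 htb)]
  have hinf := hmin.isGLB.csInf_eq (Set.range_nonempty _)
  simp only [cvar, hint]
  rw [iInf, hinf]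
  field_simp

theorem integral_mul_ite_const {Ω : Type*} [MeasurableSpace Ω] {P : Measure Ω} {f : Ω → ℝ}
    (hf : Integrable f P) {s : Set Ω} [DecidablePred (· ∈ s)] (hs : MeasurableSet s) (a b : ℝ) :
    ∫ ω, f ω * (if ω ∈ s then a else b) ∂P =
      (a - b) * (∫ ω in s, f ω ∂P) + b * ∫ ω, f ω ∂P := by
  have h : (fun ω => f ω * (if ω ∈ s then a else b)) =
      fun ω => (a - b) * s.indicator f ω + b * f ω := by
    funext ω
    by_cases hω : ω ∈ s <;> simp [hω] <;> ring
  rw [h, integral_add ((hf.indicator hs).const_mul _) (hf.const_mul _), integral_const_mul,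
    integral_const_mul, integral_indicator hs]

/-- The `Star-System` `X* = x_d·1_{A*} + x*·1_{B*}` satisfies the capital constraint and
its CVaR equals `−x_r + (1/λ)(x* − x_d)(P(A*) − λ·P̃(A*))`. -/
theorem star_system_cvar_formula
    {Ω : Type*} [MeasurableSpace Ω] (P : Measure Ω) [IsProbabilityMeasure P]
    (ρ : Ω → ℝ) (hρm : Measurable ρ) (hρpos : ∀ ω, 0 < ρ ω)
    (hρint : Integrable ρ P) (hρ1 : ∫ ω, ρ ω ∂P = 1)
    (x_d x_r : ℝ) (hdr : x_d < x_r)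
    (lam : ℝ) (hlam : lam ∈ Set.Ioo (0 : ℝ) 1)
    (astar : ℝ) (ha : 0 < astar)
    (hPA : (P {ω | astar < ρ ω}).toReal ≤ lam)
    (hPtA : (∫ ω in {ω | astar < ρ ω}, ρ ω ∂P) < 1)
    (xstar : ℝ)
    (hxstar : xstar = (x_r - x_d * ∫ ω in {ω | astar < ρ ω}, ρ ω ∂P) /
      (1 - ∫ ω in {ω | astar < ρ ω}, ρ ω ∂P))
    (hdx : x_d < xstar)
    (Xstar : Ω → ℝ)
    (hXstar : Xstar = fun ω => if astar < ρ ω then x_d else xstar) :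
    (∫ ω, ρ ω * Xstar ω ∂P = x_r) ∧
    cvar P lam Xstar = -x_r + (1 / lam) * (xstar - x_d) *
      ((P {ω | astar < ρ ω}).toReal - lam * ∫ ω in {ω | astar < ρ ω}, ρ ω ∂P) := by
  have hs : MeasurableSet {ω | astar < ρ ω} := measurableSet_lt measurable_const hρm
  have hcap : xstar * (1 - ∫ ω in {ω | astar < ρ ω}, ρ ω ∂P) =
      x_r - x_d * ∫ ω in {ω | astar < ρ ω}, ρ ω ∂P := by
    rw [hxstar, div_mul_cancel₀ _ (sub_pos.2 hPtA).ne']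
  have hE := integral_mul_ite_const hρint hs x_d xstar
  have hC := cvar_ite_const P hs hlam.1 hlam.2.le hPA hdx.le
  simp only [Set.mem_ofPred_eq] at hE hC
  have hlam0 : lam ≠ 0 := hlam.1.ne'
  subst hXstar
  constructor
  · rw [hE, hρ1]
    linarith
  · rw [hC, measureReal_def]
    field_simp
    linear_combination -lam * hcap
end

section
/- Let x_r ≤ x₁ < x₂ ≤ x_u and 0 < a₂ < a₁, and define the two-line configurations X₁ = x_d·1_{ρ>a₁} + x₁·1_{ρ≤a₁} and X₂ = x_d·1_{ρ>a₂} + x₂·1_{ρ≤a₂}. If both satisfy the capital constraint E[ρ·X₁] = x_r and E[ρ·X₂] = x_r, then E[X₁] < E[X₂]. (The expected return of capital-feasible two-line configurations of this form strictly increases as the upper level x increases from x_r to x_u.) -/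
open MeasureTheory

/-- The product of an integrable function with a two-valued threshold function of a measurable
random variable is integrable. -/
lemma integrable_mul_threshold {Ω : Type*} [MeasurableSpace Ω] {P : Measure Ω} [IsFiniteMeasure P]
    {ρ f : Ω → ℝ} (hρ : Measurable ρ) (hf : Integrable f P) (a c d : ℝ) :
    Integrable (fun ω => f ω * if a < ρ ω then c else d) P := by
  have hm : Measurable fun ω => if a < ρ ω then c else d :=
    Measurable.ite (measurableSet_lt measurable_const hρ) measurable_const measurable_const
  refine hf.mul_bdd (c := max |c| |d|) hm.aestronglyMeasurable (.of_forall fun ω => ?_)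
  split_ifs
  · exact le_max_left _ _
  · exact le_max_right _ _

/-- The expected return of capital-feasible two-line configurations
`X = x_d·1_{ρ>a} + x·1_{ρ≤a}` strictly increases as the upper level `x`
increases from `x_r` to `x_u`. -/
theorem two_line_return_increases_in_upper_level
    {Ω : Type*} [MeasurableSpace Ω] (P : Measure Ω) [IsProbabilityMeasure P]
    (ρ : Ω → ℝ) (hρm : Measurable ρ) (hρpos : ∀ ω, 0 < ρ ω)
    (hρint : Integrable ρ P) (hρ1 : ∫ ω, ρ ω ∂P = 1)
    (x_d x_r x_u : ℝ) (hdr : x_d < x_r) (hru : x_r < x_u)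
    (x₁ x₂ a₁ a₂ : ℝ) (hr1 : x_r ≤ x₁) (h12 : x₁ < x₂) (h2u : x₂ ≤ x_u)
    (ha2 : 0 < a₂) (ha21 : a₂ < a₁)
    (X₁ X₂ : Ω → ℝ)
    (hX₁ : X₁ = fun ω => if a₁ < ρ ω then x_d else x₁)
    (hX₂ : X₂ = fun ω => if a₂ < ρ ω then x_d else x₂)
    (hcap₁ : ∫ ω, ρ ω * X₁ ω ∂P = x_r)
    (hcap₂ : ∫ ω, ρ ω * X₂ ω ∂P = x_r) :
    ∫ ω, X₁ ω ∂P < ∫ ω, X₂ ω ∂P := by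
  have hi₁ : Integrable X₁ P := by
    simpa [hX₁] using integrable_mul_threshold hρm (integrable_const (1 : ℝ)) a₁ x_d x₁
  have hi₂ : Integrable X₂ P := by
    simpa [hX₂] using integrable_mul_threshold hρm (integrable_const (1 : ℝ)) a₂ x_d x₂
  have hj₁ : Integrable (fun ω => ρ ω * X₁ ω) P := by
    simpa only [hX₁] using integrable_mul_threshold hρm hρint a₁ x_d x₁
  have hj₂ : Integrable (fun ω => ρ ω * X₂ ω) P := by
    simpa only [hX₂] using integrable_mul_threshold hρm hρint a₂ x_d x₂
  have hD : Integrable (fun ω => X₂ ω - X₁ ω) P := hi₂.sub hi₁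
  have hρD : Integrable (fun ω => ρ ω * X₂ ω - ρ ω * X₁ ω) P := hj₂.sub hj₁
  have hρD0 : ∫ ω, (ρ ω * X₂ ω - ρ ω * X₁ ω) ∂P = 0 := by
    rw [integral_sub hj₂ hj₁, hcap₁, hcap₂, sub_self]
  have hG : Integrable
      (fun ω => a₂ * (X₂ ω - X₁ ω) - (ρ ω * X₂ ω - ρ ω * X₁ ω)) P :=
    (hD.const_mul a₂).sub hρD
  have hGint : ∫ ω, (a₂ * (X₂ ω - X₁ ω) - (ρ ω * X₂ ω - ρ ω * X₁ ω)) ∂P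
      = a₂ * (∫ ω, X₂ ω ∂P - ∫ ω, X₁ ω ∂P) := by
    rw [integral_sub (hD.const_mul a₂) hρD, hρD0, integral_const_mul, integral_sub hi₂ hi₁,
      sub_zero]
  -- The three regions on which the difference of the two configurations is constant.
  have hcases : ∀ ω, (ρ ω ≤ a₂ ∧ X₂ ω = x₂ ∧ X₁ ω = x₁) ∨
      (a₂ < ρ ω ∧ X₂ ω = x_d ∧ X₁ ω = x₁) ∨ (X₂ ω = x_d ∧ X₁ ω = x_d) := by
    intro ω
    rcases le_or_gt (ρ ω) a₂ with h | h
    · exact .inl ⟨h, by simp [hX₂, h.not_gt], by simp [hX₁, (h.trans ha21.le).not_gt]⟩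
    · rcases le_or_gt (ρ ω) a₁ with h' | h'
      · exact .inr (.inl ⟨h, by simp [hX₂, h], by simp [hX₁, h'.not_gt]⟩)
      · exact .inr (.inr ⟨by simp [hX₂, h], by simp [hX₁, h']⟩)
  have hGnn : ∀ ω, 0 ≤ a₂ * (X₂ ω - X₁ ω) - (ρ ω * X₂ ω - ρ ω * X₁ ω) := by
    intro ω
    rcases hcases ω with ⟨h, h2, h1⟩ | ⟨h, h2, h1⟩ | ⟨h2, h1⟩ <;> rw [h2, h1]
    · nlinarith
    · nlinarith
    · simp
  by_contra! hle
  have hG0 : ∫ ω, (a₂ * (X₂ ω - X₁ ω) - (ρ ω * X₂ ω - ρ ω * X₁ ω)) ∂P = 0 := by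
    refine le_antisymm ?_ (integral_nonneg hGnn)
    rw [hGint]
    exact mul_nonpos_of_nonneg_of_nonpos ha2.le (sub_nonpos.2 hle)
  have hGae := (integral_eq_zero_iff_of_nonneg hGnn hG).1 hG0
  have hnn : 0 ≤ᵐ[P] fun ω => ρ ω * X₂ ω - ρ ω * X₁ ω := by
    filter_upwards [hGae] with ω hω
    simp only [Pi.zero_apply] at hω ⊢
    rcases hcases ω with ⟨h, h2, h1⟩ | ⟨h, h2, h1⟩ | ⟨h2, h1⟩ <;> rw [h2, h1] at hω ⊢
    · nlinarith [hρpos ω]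
    · nlinarith
    · simp
  have hρDae := (integral_eq_zero_iff_of_nonneg_ae hnn hρD).1 hρD0
  have hX₁ae : (fun ω => ρ ω * X₁ ω) =ᵐ[P] fun ω => ρ ω * x_d := by
    filter_upwards [hρDae] with ω hω
    simp only [Pi.zero_apply] at hω
    have hρω := hρpos ω
    rcases hcases ω with ⟨h, h2, h1⟩ | ⟨h, h2, h1⟩ | ⟨h2, h1⟩ <;> rw [h2, h1] at hω
    · nlinarith
    · nlinarith
    · rw [h1]
  rw [integral_congr_ae hX₁ae, integral_mul_const, hρ1, one_mul] at hcap₁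
  exact hdr.ne hcap₁
end

section
/- Fix x with x_d < x < x_u, let 0 < b₁ < b₂ < a₂ < a₁, and define the three-line configurations X_i = x_d·1_{ρ>a_i} + x·1_{b_i≤ρ≤a_i} + x_u·1_{ρ<b_i} for i = 1, 2. Assume both satisfy the capital constraint E[ρ·X₁] = x_r and E[ρ·X₂] = x_r, and assume P(b₁ ≤ ρ < b₂) > 0. Then E[X₂] > E[X₁]. (Among capital-feasible three-line configurations with the same middle level x, the expected return strictly decreases as the lower threshold b decreases and the upper threshold a increases.) -/
open MeasureTheory

/-- Among capital-feasible three-line configurations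
`X = x_d·1_{ρ>a} + x·1_{b≤ρ≤a} + x_u·1_{ρ<b}` with the same middle level `x`, the
expected return strictly decreases as the lower threshold `b` decreases and the upper
threshold `a` increases. -/
theorem three_line_return_decreases_as_thresholds_spread
    {Ω : Type*} [MeasurableSpace Ω] (P : Measure Ω) [IsProbabilityMeasure P]
    (ρ : Ω → ℝ) (hρm : Measurable ρ) (hρpos : ∀ ω, 0 < ρ ω)
    (hρint : Integrable ρ P) (hρ1 : ∫ ω, ρ ω ∂P = 1)
    (x_d x_r x_u : ℝ) (hdr : x_d < x_r) (hru : x_r < x_u)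
    (x : ℝ) (hdx : x_d < x) (hxu : x < x_u)
    (a₁ a₂ b₁ b₂ : ℝ) (hb1 : 0 < b₁) (hb12 : b₁ < b₂) (hb2a2 : b₂ < a₂) (ha21 : a₂ < a₁)
    (X₁ X₂ : Ω → ℝ)
    (hX₁ : X₁ = fun ω => if a₁ < ρ ω then x_d else if ρ ω < b₁ then x_u else x)
    (hX₂ : X₂ = fun ω => if a₂ < ρ ω then x_d else if ρ ω < b₂ then x_u else x)
    (hcap₁ : ∫ ω, ρ ω * X₁ ω ∂P = x_r)
    (hcap₂ : ∫ ω, ρ ω * X₂ ω ∂P = x_r)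
    (hpos : 0 < P {ω | b₁ ≤ ρ ω ∧ ρ ω < b₂}) :
    ∫ ω, X₁ ω ∂P < ∫ ω, X₂ ω ∂P := by
  have hmeas (a b : ℝ) :
      Measurable fun ω => if a < ρ ω then x_d else if ρ ω < b then x_u else x :=
    Measurable.ite (measurableSet_lt measurable_const hρm) measurable_const
      (Measurable.ite (measurableSet_lt hρm measurable_const) measurable_const measurable_const)
  have hbound (a b : ℝ) : ∀ ω,
      ‖if a < ρ ω then x_d else if ρ ω < b then x_u else x‖ ≤ |x_d| + |x_u| + |x| := by
    intro ω
    have h₁ := abs_nonneg x_d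
    have h₂ := abs_nonneg x_u
    have h₃ := abs_nonneg x
    rw [Real.norm_eq_abs]
    split_ifs <;> linarith
  have hm₁ : Measurable X₁ := hX₁ ▸ hmeas a₁ b₁
  have hm₂ : Measurable X₂ := hX₂ ▸ hmeas a₂ b₂
  have hB₁ : ∀ ω, ‖X₁ ω‖ ≤ |x_d| + |x_u| + |x| := hX₁ ▸ hbound a₁ b₁
  have hB₂ : ∀ ω, ‖X₂ ω‖ ≤ |x_d| + |x_u| + |x| := hX₂ ▸ hbound a₂ b₂
  have hi₁ : Integrable X₁ P := .of_bound hm₁.aestronglyMeasurable _ (.of_forall hB₁)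
  have hi₂ : Integrable X₂ P := .of_bound hm₂.aestronglyMeasurable _ (.of_forall hB₂)
  have hρi₁ : Integrable (fun ω => ρ ω * X₁ ω) P :=
    hρint.mul_bdd hm₁.aestronglyMeasurable (.of_forall hB₁)
  have hρi₂ : Integrable (fun ω => ρ ω * X₂ ω) P :=
    hρint.mul_bdd hm₂.aestronglyMeasurable (.of_forall hB₂)
  have hd : Integrable (fun ω => b₂ * (X₂ ω - X₁ ω)) P := (hi₂.sub hi₁).const_mul b₂
  have hρd : Integrable (fun ω => ρ ω * X₂ ω - ρ ω * X₁ ω) P := hρi₂.sub hρi₁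
  -- The weight `b₂ - ρ` has the same sign as `X₂ - X₁` wherever the latter is nonzero.
  let g : Ω → ℝ := fun ω => b₂ * (X₂ ω - X₁ ω) - (ρ ω * X₂ ω - ρ ω * X₁ ω)
  have hg (ω : Ω) : g ω = (b₂ - ρ ω) * (X₂ ω - X₁ ω) := by simp only [g]; ring
  have hgi : Integrable g P := hd.sub hρd
  have hg_nonneg : 0 ≤ g := by
    intro ω
    rw [Pi.zero_apply, hg, hX₁, hX₂]
    dsimp only
    split_ifs <;> first | (exfalso; linarith) | nlinarith
  have hg_pos : 0 < ∫ ω, g ω ∂P := by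
    rw [integral_pos_iff_support_of_nonneg hg_nonneg hgi]
    refine hpos.trans_le (measure_mono fun ω ⟨h₁, h₂⟩ => ?_)
    have hX : X₂ ω - X₁ ω = x_u - x := by
      simp only [hX₁, hX₂, h₂, if_true, if_neg h₁.not_gt,
        if_neg (show ¬ a₁ < ρ ω by linarith), if_neg (show ¬ a₂ < ρ ω by linarith)]
    rw [Function.mem_support, hg, hX]
    exact (mul_pos (sub_pos.2 h₂) (sub_pos.2 hxu)).ne'
  have hg_int : ∫ ω, g ω ∂P = b₂ * (∫ ω, X₂ ω ∂P - ∫ ω, X₁ ω ∂P) := by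
    simp only [g]
    rw [integral_sub hd hρd, integral_const_mul,
      integral_sub hi₂ hi₁, integral_sub hρi₂ hρi₁, hcap₁, hcap₂, sub_self, sub_zero]
  rw [hg_int] at hg_pos
  exact sub_pos.1 (pos_of_mul_pos_right hg_pos (hb1.trans hb12).le)
end

section
/- Fix t with x_d < t < x_u and thresholds 0 ≤ b < a < ∞, and set X̂ = x_d·1_{ρ>a} + t·1_{b≤ρ≤a} + x_u·1_{ρ<b}. Then for every measurable X with x_d ≤ X ≤ x_u almost surely: E[(t − X)⁺ + ((ρ − b)/(a − b))·X] ≥ E[(t − X̂)⁺ + ((ρ − b)/(a − b))·X̂]. (The three-line configuration minimizes the Lagrangian functional E[(t − X)⁺ + ((ρ−b)/(a−b))·X] over all random variables bounded between x_d and x_u.) -/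
open MeasureTheory

/-- Pointwise minimization of `x ↦ (t - x)⁺ + l * x` over `[c, d]`, where `l` is the affine
function of `r` taking the values `0` at `b` and `1` at `a`. -/
theorem max_sub_add_mul_three_line_le {a b c d t r x : ℝ} (hba : b < a) (hct : c < t)
    (htd : t < d) (hcx : c ≤ x) (hxd : x ≤ d) :
    max (t - if a < r then c else if r < b then d else t) 0
        + (r - b) / (a - b) * (if a < r then c else if r < b then d else t) ≤
      max (t - x) 0 + (r - b) / (a - b) * x := by
  have hab : 0 < a - b := sub_pos.2 hba
  have h₁ := le_max_left (t - x) 0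
  have h₂ := le_max_right (t - x) 0
  split_ifs with har hrb
  · have hl : 1 ≤ (r - b) / (a - b) := (one_le_div hab).2 (by linarith)
    rw [max_eq_left (by linarith)]
    nlinarith
  · have hl : (r - b) / (a - b) ≤ 0 := div_nonpos_of_nonpos_of_nonneg (by linarith) hab.le
    rw [max_eq_right (by linarith)]
    nlinarith
  · have hl₀ : 0 ≤ (r - b) / (a - b) := div_nonneg (by linarith) hab.le
    have hl₁ : (r - b) / (a - b) ≤ 1 := (div_le_one hab).2 (by linarith)
    rw [sub_self, max_self]
    nlinarith

/-- `(t - X)⁺ + l * X` is integrable for an essentially bounded `X` and an integrable `l`. -/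
theorem integrable_max_sub_add_mul {Ω : Type*} [MeasurableSpace Ω] {P : Measure Ω}
    [IsFiniteMeasure P] {X l : Ω → ℝ} {c d : ℝ} (t : ℝ) (hl : Integrable l P)
    (hXm : AEStronglyMeasurable X P) (hX : ∀ᵐ ω ∂P, c ≤ X ω ∧ X ω ≤ d) :
    Integrable (fun ω => max (t - X ω) 0 + l ω * X ω) P := by
  have hbound : ∀ᵐ ω ∂P, ‖X ω‖ ≤ max |c| |d| := by
    filter_upwards [hX] with ω hω using abs_le_max_abs_abs hω.1 hω.2
  have hXi : Integrable X P := Integrable.of_bound hXm _ hbound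
  exact ((integrable_const t).sub hXi).pos_part.add (hl.mul_bdd hXm hbound)

/-- The three-line configuration `X̂ = x_d·1_{ρ>a} + t·1_{b≤ρ≤a} + x_u·1_{ρ<b}` minimizes
the Lagrangian functional `E[(t − X)⁺ + ((ρ − b)/(a − b))·X]` over all random variables
bounded between `x_d` and `x_u`. -/
theorem three_line_minimizes_lagrangian
    {Ω : Type*} [MeasurableSpace Ω] (P : Measure Ω) [IsProbabilityMeasure P]
    (ρ : Ω → ℝ) (hρm : Measurable ρ) (hρpos : ∀ ω, 0 < ρ ω)
    (hρint : Integrable ρ P) (hρ1 : ∫ ω, ρ ω ∂P = 1)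
    (x_d x_u : ℝ) (hdu : x_d < x_u)
    (t a b : ℝ) (hdt : x_d < t) (htu : t < x_u) (hb : 0 ≤ b) (hba : b < a)
    (Xhat : Ω → ℝ)
    (hXhat : Xhat = fun ω => if a < ρ ω then x_d else if ρ ω < b then x_u else t) :
    ∀ X : Ω → ℝ, Measurable X → (∀ᵐ ω ∂P, x_d ≤ X ω ∧ X ω ≤ x_u) →
      (∫ ω, (max (t - Xhat ω) 0 + (ρ ω - b) / (a - b) * Xhat ω) ∂P) ≤
      ∫ ω, (max (t - X ω) 0 + (ρ ω - b) / (a - b) * X ω) ∂P := by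
  intro X hXm hX
  have hl : Integrable (fun ω => (ρ ω - b) / (a - b)) P :=
    (hρint.sub (integrable_const b)).div_const _
  have hXhm : Measurable Xhat := by
    rw [hXhat]
    exact Measurable.ite (measurableSet_lt measurable_const hρm) measurable_const
      (Measurable.ite (measurableSet_lt hρm measurable_const) measurable_const measurable_const)
  have hXh : ∀ ω, x_d ≤ Xhat ω ∧ Xhat ω ≤ x_u := by
    intro ω
    simp only [hXhat]
    split_ifs <;> constructor <;> linarith
  refine integral_mono_ae
    (integrable_max_sub_add_mul t hl hXhm.aestronglyMeasurable (.of_forall hXh))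
    (integrable_max_sub_add_mul t hl hXm.aestronglyMeasurable hX) ?_
  filter_upwards [hX] with ω hω
  simp only [hXhat]
  exact max_sub_add_mul_three_line_le hba hdt htu hω.1 hω.2
end

section
/- Fix t with x_d < t < x_u, thresholds 0 ≤ b̂ < â < ∞, and set X̂ = x_d·1_{ρ>â} + t·1_{b̂≤ρ≤â} + x_u·1_{ρ<b̂}. Assume X̂ satisfies the return constraint E[X̂] = z and the capital constraint E[ρ·X̂] = x_r. Then X̂ minimizes the expected shortfall at level t under both constraints: for every measurable X with x_d ≤ X ≤ x_u almost surely, E[X] ≥ z and E[ρ·X] = x_r, one has E[(t − X)⁺] ≥ E[(t − X̂)⁺] = (t − x_d)·P(ρ > â). -/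
open MeasureTheory

/-- The three-line value minimizes the Lagrangian of the shortfall pointwise, with multipliers
`b / (a - b)` for the return and `1 / (a - b)` for the capital constraint. -/
theorem three_line_pointwise_lagrangian {x_d x_u t a b r x : ℝ} (hdt : x_d ≤ t) (htu : t ≤ x_u)
    (hba : b ≤ a) (hx : x_d ≤ x ∧ x ≤ x_u) :
    b * (x - (if a < r then x_d else if r < b then x_u else t)) -
        (r * x - r * (if a < r then x_d else if r < b then x_u else t)) ≤
      (a - b) * (max (t - x) 0 -
        max (t - (if a < r then x_d else if r < b then x_u else t)) 0) := by
  obtain ⟨hdx, hxu⟩ := hx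
  split_ifs with ha hb
  · rw [max_eq_left (sub_nonneg.2 hdt)]
    rcases le_total x t with h | h
    · rw [max_eq_left (sub_nonneg.2 h)]
      nlinarith
    · rw [max_eq_right (sub_nonpos.2 h)]
      nlinarith
  · rw [max_eq_right (sub_nonpos.2 htu)]
    rcases le_total x t with h | h
    · rw [max_eq_left (sub_nonneg.2 h)]
      nlinarith
    · rw [max_eq_right (sub_nonpos.2 h)]
      nlinarith
  · rw [sub_self, max_self]
    rcases le_total x t with h | h
    · rw [max_eq_left (sub_nonneg.2 h)]
      nlinarith
    · rw [max_eq_right (sub_nonpos.2 h)]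
      nlinarith

/-- An almost surely bounded measurable function times an integrable one is integrable. -/
theorem integrable_mul_of_ae_mem_Icc {Ω : Type*} [MeasurableSpace Ω] {P : Measure Ω}
    {g X : Ω → ℝ} {l u : ℝ} (hg : Integrable g P) (hX : Measurable X)
    (hlu : ∀ᵐ ω ∂P, l ≤ X ω ∧ X ω ≤ u) : Integrable (fun ω => g ω * X ω) P := by
  refine hg.mul_bdd (c := max |l| |u|) hX.aestronglyMeasurable ?_
  filter_upwards [hlu] with ω hω
  exact abs_le_max_abs_abs hω.1 hω.2

/-- The three-line configuration `X̂ = x_d·1_{ρ>â} + t·1_{b̂≤ρ≤â} + x_u·1_{ρ<b̂}`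
satisfying the return and capital constraints minimizes the expected shortfall at level
`t` among all feasible portfolios, and its shortfall equals `(t − x_d)·P(ρ > â)`. -/
theorem three_line_minimizes_expected_shortfall_two_constraints
    {Ω : Type*} [MeasurableSpace Ω] (P : Measure Ω) [IsProbabilityMeasure P]
    (ρ : Ω → ℝ) (hρm : Measurable ρ) (hρpos : ∀ ω, 0 < ρ ω)
    (hρint : Integrable ρ P) (hρ1 : ∫ ω, ρ ω ∂P = 1)
    (x_d x_u : ℝ) (hdu : x_d < x_u) (z x_r : ℝ)
    (t ahat bhat : ℝ) (hdt : x_d < t) (htu : t < x_u) (hb : 0 ≤ bhat) (hba : bhat < ahat)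
    (Xhat : Ω → ℝ)
    (hXhat : Xhat = fun ω => if ahat < ρ ω then x_d else if ρ ω < bhat then x_u else t)
    (hret : ∫ ω, Xhat ω ∂P = z)
    (hcap : ∫ ω, ρ ω * Xhat ω ∂P = x_r) :
    (∫ ω, max (t - Xhat ω) 0 ∂P = (t - x_d) * (P {ω | ahat < ρ ω}).toReal) ∧
    ∀ X : Ω → ℝ, Measurable X → (∀ᵐ ω ∂P, x_d ≤ X ω ∧ X ω ≤ x_u) →
      z ≤ ∫ ω, X ω ∂P → (∫ ω, ρ ω * X ω ∂P = x_r) →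
      (∫ ω, max (t - Xhat ω) 0 ∂P) ≤ ∫ ω, max (t - X ω) 0 ∂P := by
  have hXm : Measurable Xhat := by
    rw [hXhat]
    exact Measurable.ite (measurableSet_lt measurable_const hρm) measurable_const
      (Measurable.ite (measurableSet_lt hρm measurable_const) measurable_const measurable_const)
  have hXbd : ∀ᵐ ω ∂P, x_d ≤ Xhat ω ∧ Xhat ω ≤ x_u := by
    refine Filter.Eventually.of_forall fun ω => ?_
    simp only [hXhat]
    split_ifs <;> constructor <;> linarith
  have integrable_of_bounds : ∀ X : Ω → ℝ, Measurable X →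
      (∀ᵐ ω ∂P, x_d ≤ X ω ∧ X ω ≤ x_u) → Integrable X P := fun X hX hbd => by
    simpa using integrable_mul_of_ae_mem_Icc (integrable_const (1 : ℝ)) hX hbd
  have integrable_shortfall : ∀ X : Ω → ℝ, Integrable X P →
      Integrable (fun ω => max (t - X ω) 0) P := fun X hX =>
    ((integrable_const t).sub hX).pos_part
  refine ⟨?_, fun X hX hbd hz hr => ?_⟩
  · have hset : MeasurableSet {ω | ahat < ρ ω} := measurableSet_lt measurable_const hρm
    have heq : (fun ω => max (t - Xhat ω) 0) =
        {ω | ahat < ρ ω}.indicator fun _ => t - x_d := by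
      funext ω
      simp only [hXhat, Set.indicator_apply, Set.mem_ofPred_eq]
      split_ifs
      · exact max_eq_left (by linarith)
      · exact max_eq_right (by linarith)
      · simp
    rw [heq, integral_indicator_const _ hset, smul_eq_mul, mul_comm, measureReal_def]
  · have hXi := integrable_of_bounds X hX hbd
    have hXhi := integrable_of_bounds Xhat hXm hXbd
    have hρX := integrable_mul_of_ae_mem_Icc hρint hX hbd
    have hρXh := integrable_mul_of_ae_mem_Icc hρint hXm hXbd
    have hs := integrable_shortfall X hXi
    have hsh := integrable_shortfall Xhat hXhi
    have hret_diff : Integrable (fun ω => bhat * (X ω - Xhat ω)) P :=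
      (hXi.sub hXhi).const_mul bhat
    have hcap_diff : Integrable (fun ω => ρ ω * X ω - ρ ω * Xhat ω) P := hρX.sub hρXh
    have key : ∫ ω, (bhat * (X ω - Xhat ω) - (ρ ω * X ω - ρ ω * Xhat ω)) ∂P ≤
        ∫ ω, (ahat - bhat) * (max (t - X ω) 0 - max (t - Xhat ω) 0) ∂P := by
      refine integral_mono_ae (hret_diff.sub hcap_diff)
        ((hs.sub hsh).const_mul _) ?_
      filter_upwards [hbd] with ω hω
      simp only [hXhat]
      exact three_line_pointwise_lagrangian hdt.le htu.le hba.le hω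
    rw [integral_sub hret_diff hcap_diff, integral_const_mul,
      integral_const_mul, integral_sub hXi hXhi, integral_sub hρX hρXh, integral_sub hs hsh,
      hret, hcap, hr] at key
    have hnonneg := mul_nonneg hb (sub_nonneg.2 hz)
    refine sub_nonneg.1 (nonneg_of_mul_nonneg_right ?_ (sub_pos.2 hba))
    linarith
end

section
/- Fix t with x_d < t ≤ x_u and a threshold a > 0, and set X̂ = x_d·1_{ρ>a} + t·1_{ρ≤a}. Assume the capital constraint E[ρ·X̂] = x_r holds. Then X̂ minimizes the expected shortfall at level t under the capital constraint alone: for every measurable X with x_d ≤ X ≤ x_u almost surely and E[ρ·X] = x_r, one has E[(t − X)⁺] ≥ E[(t − X̂)⁺] = (t − x_d)·P(ρ > a). -/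
open MeasureTheory

/-- Pointwise Neyman–Pearson inequality: the gain in shortfall of the two-line configuration over
`x ≥ x_d`, priced at `a`, dominates the difference of the state-price-weighted payoffs. -/
theorem mul_sub_two_line_le_mul_shortfall_sub {x_d t a r x : ℝ} (hdt : x_d ≤ t) (ha : 0 ≤ a)
    (hr : 0 ≤ r) (hx : x_d ≤ x) :
    r * (if a < r then x_d else t) - r * x ≤
      a * (max (t - x) 0 - max (t - if a < r then x_d else t) 0) := by
  split_ifs with h
  · rw [max_eq_left (sub_nonneg.2 hdt)]
    nlinarith [mul_le_mul_of_nonneg_left (le_max_left (t - x) 0) ha,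
      mul_nonneg (sub_nonneg.2 h.le) (sub_nonneg.2 hx)]
  · rw [sub_self, max_self, sub_zero]
    nlinarith [mul_le_mul_of_nonneg_left (le_max_left (t - x) 0) hr,
      mul_le_mul_of_nonneg_right (not_lt.1 h) (le_max_right (t - x) 0)]

/-- The two-line configuration `X̂ = x_d·1_{ρ>a} + t·1_{ρ≤a}` satisfying the capital
constraint minimizes the expected shortfall at level `t` among all portfolios bounded in
`[x_d, x_u]` with initial capital `x_r`, and its shortfall equals `(t − x_d)·P(ρ > a)`. -/
theorem two_line_minimizes_expected_shortfall_capital_constraint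
    {Ω : Type*} [MeasurableSpace Ω] (P : Measure Ω) [IsProbabilityMeasure P]
    (ρ : Ω → ℝ) (hρm : Measurable ρ) (hρpos : ∀ ω, 0 < ρ ω)
    (hρint : Integrable ρ P) (hρ1 : ∫ ω, ρ ω ∂P = 1)
    (x_d x_u : ℝ) (hdu : x_d < x_u) (x_r : ℝ)
    (t a : ℝ) (hdt : x_d < t) (htu : t ≤ x_u) (ha : 0 < a)
    (Xhat : Ω → ℝ)
    (hXhat : Xhat = fun ω => if a < ρ ω then x_d else t)
    (hcap : ∫ ω, ρ ω * Xhat ω ∂P = x_r) :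
    (∫ ω, max (t - Xhat ω) 0 ∂P = (t - x_d) * (P {ω | a < ρ ω}).toReal) ∧
    ∀ X : Ω → ℝ, Measurable X → (∀ᵐ ω ∂P, x_d ≤ X ω ∧ X ω ≤ x_u) →
      (∫ ω, ρ ω * X ω ∂P = x_r) →
      (∫ ω, max (t - Xhat ω) 0 ∂P) ≤ ∫ ω, max (t - X ω) 0 ∂P := by
  subst hXhat
  have hS : MeasurableSet {ω | a < ρ ω} := measurableSet_lt measurable_const hρm
  have hXm : Measurable fun ω => if a < ρ ω then x_d else t :=
    Measurable.ite hS measurable_const measurable_const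
  have hprice : ∀ Y : Ω → ℝ, Measurable Y → (∀ᵐ ω ∂P, x_d ≤ Y ω ∧ Y ω ≤ x_u) →
      Integrable (fun ω => ρ ω * Y ω) P := fun Y hY hb =>
    hρint.mul_bdd (c := max |x_d| |x_u|) hY.aestronglyMeasurable <| by
      filter_upwards [hb] with ω hω
      exact abs_le_max_abs_abs hω.1 hω.2
  have hshort : ∀ Y : Ω → ℝ, Measurable Y → (∀ᵐ ω ∂P, x_d ≤ Y ω ∧ Y ω ≤ x_u) →
      Integrable (fun ω => max (t - Y ω) 0) P := fun Y hY hb =>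
    Integrable.pos_part <| (integrable_const t).sub <|
      .of_bound hY.aestronglyMeasurable (max |x_d| |x_u|) <| by
        filter_upwards [hb] with ω hω
        exact abs_le_max_abs_abs hω.1 hω.2
  have hXb : ∀ᵐ ω ∂P, x_d ≤ (if a < ρ ω then x_d else t) ∧
      (if a < ρ ω then x_d else t) ≤ x_u := by
    refine .of_forall fun ω => ?_
    split_ifs
    exacts [⟨le_rfl, hdu.le⟩, ⟨hdt.le, htu⟩]
  refine ⟨?_, fun X hX hb hXcap => ?_⟩
  · have hind : (fun ω => max (t - if a < ρ ω then x_d else t) 0) =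
        {ω | a < ρ ω}.indicator fun _ => t - x_d := by
      ext ω
      by_cases h : a < ρ ω <;> simp [h, hdt.le]
    rw [hind, integral_indicator_const _ hS, smul_eq_mul, mul_comm, measureReal_def]
  · have key := integral_mono_ae ((hprice _ hXm hXb).sub (hprice X hX hb))
      (((hshort X hX hb).sub (hshort _ hXm hXb)).const_mul a) <| by
        filter_upwards [hb] with ω hω
        exact mul_sub_two_line_le_mul_shortfall_sub hdt.le ha.le (hρpos ω).le hω.1
    simp only [Pi.sub_apply] at key
    rw [integral_sub (hprice _ hXm hXb) (hprice X hX hb), hcap, hXcap, sub_self,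
      integral_const_mul, integral_sub (hshort X hX hb) (hshort _ hXm hXb)] at key
    exact sub_nonneg.1 (nonneg_of_mul_nonneg_right key ha)
end

section
/- Let λ ∈ (0,1) and assume ρ ≤ 1/λ almost surely. Let X be a measurable random variable with X ≥ x_d almost surely and E[ρ·X] = x_r. Then for every t ∈ ℝ one has E[(t − X)⁺] − λ·t ≥ −λ·x_r; consequently CVaR_λ(X) ≥ −x_r, and the pure money-market portfolio X ≡ x_r attains this bound since CVaR_λ(x_r) = −x_r. -/
open MeasureTheory

/-- The shortfall `(t − X)⁺` of a random variable bounded below is integrable. -/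
lemma integrable_shortfall {Ω : Type*} [MeasurableSpace Ω] {P : Measure Ω} [IsFiniteMeasure P]
    {X : Ω → ℝ} (hX : AEStronglyMeasurable X P) {b : ℝ} (hb : ∀ᵐ ω ∂P, b ≤ X ω) (t : ℝ) :
    Integrable (fun ω => max (t - X ω) 0) P := by
  refine Integrable.of_bound
    ((aestronglyMeasurable_const.sub hX).sup aestronglyMeasurable_const) (max (t - b) 0) ?_
  filter_upwards [hb] with ω hω
  rw [Real.norm_of_nonneg (le_max_right _ _)]
  exact max_le_max (by linarith) le_rfl

/-- Testing against a density `ρ` with `l * ρ ≤ 1` bounds the expected shortfall from below. -/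
lemma mul_sub_integral_le_integral_shortfall {Ω : Type*} [MeasurableSpace Ω] {P : Measure Ω}
    {ρ X : Ω → ℝ} {l t : ℝ} (hl : 0 ≤ l) (hρ0 : ∀ᵐ ω ∂P, 0 ≤ ρ ω) (hρl : ∀ᵐ ω ∂P, l * ρ ω ≤ 1)
    (hρint : Integrable ρ P) (hρ1 : ∫ ω, ρ ω ∂P = 1)
    (hXint : Integrable (fun ω => ρ ω * X ω) P)
    (hS : Integrable (fun ω => max (t - X ω) 0) P) :
    l * (t - ∫ ω, ρ ω * X ω ∂P) ≤ ∫ ω, max (t - X ω) 0 ∂P := by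
  have hint : Integrable (fun ω => l * (ρ ω * t - ρ ω * X ω)) P :=
    ((hρint.mul_const t).sub hXint).const_mul l
  calc l * (t - ∫ ω, ρ ω * X ω ∂P) = ∫ ω, l * (ρ ω * t - ρ ω * X ω) ∂P := by
        rw [integral_const_mul, integral_sub (hρint.mul_const t) hXint, integral_mul_const, hρ1,
          one_mul]
    _ ≤ ∫ ω, max (t - X ω) 0 ∂P := by
        refine integral_mono_ae hint hS ?_
        filter_upwards [hρ0, hρl] with ω h0 h1
        calc l * (ρ ω * t - ρ ω * X ω) = l * ρ ω * (t - X ω) := by ring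
          _ ≤ l * ρ ω * max (t - X ω) 0 :=
            mul_le_mul_of_nonneg_left (le_max_left _ _) (mul_nonneg hl h0)
          _ ≤ max (t - X ω) 0 := mul_le_of_le_one_left (le_max_right _ _) h1

lemma neg_le_cvar {Ω : Type*} [MeasurableSpace Ω] {P : Measure Ω} {l x : ℝ} {X : Ω → ℝ}
    (hl : 0 < l) (h : ∀ t : ℝ, -l * x ≤ (∫ ω, max (t - X ω) 0 ∂P) - l * t) :
    -x ≤ cvar P l X := by
  rw [cvar, one_div, le_inv_mul_iff₀ hl]
  exact le_ciInf fun t => by linarith [h t]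

lemma cvar_const {Ω : Type*} [MeasurableSpace Ω] (P : Measure Ω) [IsProbabilityMeasure P]
    {l : ℝ} (hl0 : 0 < l) (hl1 : l ≤ 1) (x : ℝ) : cvar P l (fun _ => x) = -x := by
  have h (t : ℝ) : -l * x ≤ (∫ _, max (t - x) 0 ∂P) - l * t := by
    simp only [integral_const, probReal_univ, one_smul]
    have := mul_le_of_le_one_left (le_max_right (t - x) 0) hl1
    have := mul_le_mul_of_nonneg_left (le_max_left (t - x) 0) hl0.le
    linarith
  refine le_antisymm ?_ (neg_le_cvar hl0 h)
  rw [cvar, one_div, inv_mul_le_iff₀ hl0]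
  refine (ciInf_le ⟨-l * x, Set.forall_mem_range.2 h⟩ x).trans ?_
  simp

/-- If `ρ ≤ 1/λ` a.s., then every portfolio `X ≥ x_d` with capital `x_r` satisfies
`E[(t − X)⁺] − λ·t ≥ −λ·x_r` for all `t`, hence `CVaR_λ(X) ≥ −x_r`; the pure
money-market portfolio `X ≡ x_r` attains this bound. -/
theorem money_market_optimal_when_density_small
    {Ω : Type*} [MeasurableSpace Ω] (P : Measure Ω) [IsProbabilityMeasure P]
    (ρ : Ω → ℝ) (hρm : Measurable ρ) (hρpos : ∀ ω, 0 < ρ ω)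
    (hρint : Integrable ρ P) (hρ1 : ∫ ω, ρ ω ∂P = 1)
    (x_d x_r : ℝ) (hdr : x_d < x_r)
    (lam : ℝ) (hlam : lam ∈ Set.Ioo (0 : ℝ) 1)
    (hρle : ∀ᵐ ω ∂P, ρ ω ≤ 1 / lam)
    (X : Ω → ℝ) (hXm : Measurable X) (hXb : ∀ᵐ ω ∂P, x_d ≤ X ω)
    (hXint : Integrable (fun ω => ρ ω * X ω) P)
    (hcap : ∫ ω, ρ ω * X ω ∂P = x_r) :
    (∀ t : ℝ, -lam * x_r ≤ (∫ ω, max (t - X ω) 0 ∂P) - lam * t) ∧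
    -x_r ≤ cvar P lam X ∧
    cvar P lam (fun _ => x_r) = -x_r := by
  have h (t : ℝ) : -lam * x_r ≤ (∫ ω, max (t - X ω) 0 ∂P) - lam * t := by
    have := mul_sub_integral_le_integral_shortfall hlam.1.le (.of_forall fun ω => (hρpos ω).le)
      (hρle.mono fun ω hω => (le_div_iff₀' hlam.1).1 hω) hρint hρ1 hXint
      (integrable_shortfall hXm.aestronglyMeasurable hXb t)
    rw [hcap] at this
    linarith
  exact ⟨h, neg_le_cvar hlam.1 h, cvar_const P hlam.1 hlam.2.le x_r⟩
end

section
/- Let λ ∈ (0,1). Assume ρ has a continuous distribution (P(ρ = c) = 0 for every c ∈ ℝ) and P(ρ > 1/λ) > 0. Let a* > 0 solve the first-order condition 1/a* = (λ − P(A*))/(1 − P̃(A*)) where A* = {ρ > a*}, assume P̃(A*) < 1, and set x* = (x_r − x_d·P̃(A*))/(1 − P̃(A*)). Then for every measurable random variable X with X ≥ x_d almost surely and E[ρ·X] = x_r (no upper bound imposed on X), one has CVaR_λ(X) ≥ −x_r + (1/λ)·(x* − x_d)·(P(A*) − λ·P̃(A*)), and the Star-System X* = x_d·1_{A*} + x*·1_{Ω∖A*}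 attains this bound. -/
open MeasureTheory

/-- Splitting `E[min(1, ρ/a)]` along the event `{a < ρ}`. -/
lemma integral_min_one_div_eq {Ω : Type*} [MeasurableSpace Ω] (P : Measure Ω)
    [IsProbabilityMeasure P] {ρ : Ω → ℝ} (hρm : Measurable ρ) (hρint : Integrable ρ P)
    {a : ℝ} (ha : 0 < a) :
    ∫ ω, min 1 (ρ ω / a) ∂P = (P {ω | a < ρ ω}).toReal +
      ((∫ ω, ρ ω ∂P) - ∫ ω in {ω | a < ρ ω}, ρ ω ∂P) / a := by
  have hA : MeasurableSet {ω | a < ρ ω} := measurableSet_lt measurable_const hρm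
  have hmin : Integrable (fun ω => min 1 (ρ ω / a)) P :=
    (integrable_const (1 : ℝ)).inf (hρint.div_const a)
  have h1 : ∫ ω in {ω | a < ρ ω}, min 1 (ρ ω / a) ∂P = (P {ω | a < ρ ω}).toReal := by
    rw [setIntegral_congr_fun (g := fun _ => (1 : ℝ)) hA
      fun ω (hω : a < ρ ω) => min_eq_left ((one_le_div ha).2 hω.le)]
    simp [Measure.real]
  have h2 : ∫ ω in {ω | a < ρ ω}ᶜ, min 1 (ρ ω / a) ∂P =
      (∫ ω in {ω | a < ρ ω}ᶜ, ρ ω ∂P) / a := by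
    rw [setIntegral_congr_fun (g := fun ω => ρ ω / a) hA.compl
      fun ω (hω : ¬ a < ρ ω) => min_eq_right ((div_le_one ha).2 (not_lt.1 hω)), integral_div]
  rw [← integral_add_compl hA hmin, h1, h2, ← integral_add_compl hA hρint]
  ring

/-- Pointwise Lagrangian bound: for `x ≥ d` the function `(t - x)⁺ + r (x - d)` is at least
`(t - d) min(1, r)`. -/
lemma mul_min_one_le_max_add_mul {t x d r : ℝ} (hr : 0 ≤ r) (hx : d ≤ x) :
    (t - d) * min 1 r ≤ max (t - x) 0 + r * (x - d) := by
  have hm0 : 0 ≤ min 1 r := le_min zero_le_one hr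
  have hm1 : min 1 r ≤ 1 := min_le_left _ _
  have hmr : min 1 r ≤ r := min_le_right _ _
  have h1 : (t - x) * min 1 r ≤ max (t - x) 0 :=
    calc (t - x) * min 1 r ≤ max (t - x) 0 * min 1 r :=
          mul_le_mul_of_nonneg_right (le_max_left _ _) hm0
      _ ≤ max (t - x) 0 := mul_le_of_le_one_right (le_max_right _ _) hm1
  have h2 : min 1 r * (x - d) ≤ r * (x - d) :=
    mul_le_mul_of_nonneg_right hmr (sub_nonneg.2 hx)
  linarith

/-- Weak duality for the expected shortfall of a portfolio bounded below by `d`, with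
multiplier `1 / a` on the budget constraint. -/
lemma le_integral_shortfall_sub_mul {Ω : Type*} [MeasurableSpace Ω] (P : Measure Ω)
    [IsProbabilityMeasure P] {ρ : Ω → ℝ} (hρpos : ∀ ω, 0 < ρ ω) (hρint : Integrable ρ P)
    (hρ1 : ∫ ω, ρ ω ∂P = 1) {a l d : ℝ} (ha : 0 < a)
    (hl : ∫ ω, min 1 (ρ ω / a) ∂P = l) {X : Ω → ℝ} (hX : Measurable X)
    (hdX : ∀ᵐ ω ∂P, d ≤ X ω) (hρX : Integrable (fun ω => ρ ω * X ω) P) (t : ℝ) :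
    -(l * d) - ((∫ ω, ρ ω * X ω ∂P) - d) / a ≤ (∫ ω, max (t - X ω) 0 ∂P) - l * t := by
  have hmin : Integrable (fun ω => min 1 (ρ ω / a)) P :=
    (integrable_const (1 : ℝ)).inf (hρint.div_const a)
  have hmax : Integrable (fun ω => max (t - X ω) 0) P := by
    refine Integrable.of_bound
      ((measurable_const.sub hX).max measurable_const).aestronglyMeasurable (max (t - d) 0) ?_
    filter_upwards [hdX] with ω hω
    rw [Real.norm_of_nonneg (le_max_right _ _)]
    exact max_le_max (by linarith) le_rfl
  have hbud : Integrable (fun ω => (ρ ω * X ω - d * ρ ω) / a) P :=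
    (hρX.sub (hρint.const_mul d)).div_const a
  have key : ∫ ω, (t - d) * min 1 (ρ ω / a) ∂P ≤
      ∫ ω, (max (t - X ω) 0 + (ρ ω * X ω - d * ρ ω) / a) ∂P := by
    refine integral_mono_ae (hmin.const_mul _) (hmax.add hbud) ?_
    filter_upwards [hdX] with ω hω
    refine (mul_min_one_le_max_add_mul (t := t) (div_nonneg (hρpos ω).le ha.le) hω).trans_eq ?_
    ring
  rw [integral_const_mul, hl, integral_add hmax hbud, integral_div,
    integral_sub hρX (hρint.const_mul d), integral_const_mul, hρ1, mul_one] at key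
  linarith

/-- With no upper bound on the portfolio, the Star-System
`X* = x_d·1_{A*} + x*·1_{Ω∖A*}` minimizes `CVaR_λ` over all portfolios bounded below by
`x_d` with initial capital `x_r`, the minimal risk being
`−x_r + (1/λ)(x* − x_d)(P(A*) − λ·P̃(A*))`. -/
theorem star_system_optimal_pure_cvar_unbounded
    {Ω : Type*} [MeasurableSpace Ω] (P : Measure Ω) [IsProbabilityMeasure P]
    (ρ : Ω → ℝ) (hρm : Measurable ρ) (hρpos : ∀ ω, 0 < ρ ω)
    (hρint : Integrable ρ P) (hρ1 : ∫ ω, ρ ω ∂P = 1)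
    (x_d x_r : ℝ) (hdr : x_d < x_r)
    (lam : ℝ) (hlam : lam ∈ Set.Ioo (0 : ℝ) 1)
    (hcont : ∀ c : ℝ, P {ω | ρ ω = c} = 0)
    (htail : 0 < P {ω | 1 / lam < ρ ω})
    (astar : ℝ) (hastar : 0 < astar)
    (heuler : 1 / astar = (lam - (P {ω | astar < ρ ω}).toReal) /
        (1 - ∫ ω in {ω | astar < ρ ω}, ρ ω ∂P))
    (hPtA : (∫ ω in {ω | astar < ρ ω}, ρ ω ∂P) < 1)
    (xstar : ℝ)
    (hxstar : xstar = (x_r - x_d * ∫ ω in {ω | astar < ρ ω}, ρ ω ∂P) /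
        (1 - ∫ ω in {ω | astar < ρ ω}, ρ ω ∂P))
    (Xstar : Ω → ℝ)
    (hXstar : Xstar = fun ω => if astar < ρ ω then x_d else xstar) :
    (∀ X : Ω → ℝ, Measurable X → (∀ᵐ ω ∂P, x_d ≤ X ω) →
      Integrable (fun ω => ρ ω * X ω) P → (∫ ω, ρ ω * X ω ∂P = x_r) →
      -x_r + (1 / lam) * (xstar - x_d) *
        ((P {ω | astar < ρ ω}).toReal - lam * ∫ ω in {ω | astar < ρ ω}, ρ ω ∂P)
        ≤ cvar P lam X) ∧
    (∫ ω, ρ ω * Xstar ω ∂P = x_r) ∧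
    cvar P lam Xstar = -x_r + (1 / lam) * (xstar - x_d) *
      ((P {ω | astar < ρ ω}).toReal - lam * ∫ ω in {ω | astar < ρ ω}, ρ ω ∂P) := by
  obtain ⟨hl0, -⟩ := hlam
  have hA : MeasurableSet {ω | astar < ρ ω} := measurableSet_lt measurable_const hρm
  have hmin := integral_min_one_div_eq P hρm hρint hastar
  rw [hρ1] at hmin
  have hsplit := integral_add_compl hA hρint
  rw [hρ1] at hsplit
  have hXmeas : Measurable Xstar := by
    rw [hXstar]
    exact Measurable.ite hA measurable_const measurable_const
  have hXint : Integrable (fun ω => ρ ω * Xstar ω) P := by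
    refine hρint.mul_bdd (c := max |x_d| |xstar|) hXmeas.aestronglyMeasurable
      (.of_forall fun ω => ?_)
    rw [hXstar]
    dsimp only
    split_ifs
    · exact le_max_left _ _
    · exact le_max_right _ _
  have hXbudget : ∫ ω, ρ ω * Xstar ω ∂P =
      x_d * (∫ ω in {ω | astar < ρ ω}, ρ ω ∂P) +
        xstar * ∫ ω in {ω | astar < ρ ω}ᶜ, ρ ω ∂P := by
    rw [← integral_add_compl hA hXint,
      setIntegral_congr_fun (g := fun ω => x_d * ρ ω) hA
        fun ω (hω : astar < ρ ω) => by simp [hXstar, hω, mul_comm],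
      setIntegral_congr_fun (g := fun ω => xstar * ρ ω) hA.compl
        fun ω (hω : ¬ astar < ρ ω) => by simp [hXstar, hω, mul_comm],
      integral_const_mul, integral_const_mul]
  have hshort (hle : x_d ≤ xstar) : ∫ ω, max (xstar - Xstar ω) 0 ∂P =
      (xstar - x_d) * (P {ω | astar < ρ ω}).toReal := by
    have : (fun ω => max (xstar - Xstar ω) 0) =
        {ω | astar < ρ ω}.indicator fun _ => xstar - x_d := by
      ext ω
      by_cases hω : astar < ρ ω <;> simp [hXstar, hω, hle]
    rw [this, integral_indicator_const _ hA, smul_eq_mul, mul_comm, Measure.real]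
  set q := ∫ ω in {ω | astar < ρ ω}, ρ ω ∂P
  set p := (P {ω | astar < ρ ω}).toReal
  have hq : 0 < 1 - q := sub_pos.2 hPtA
  have hqa : (1 - q) / astar = lam - p := by
    rw [div_eq_mul_one_div, heuler, mul_div_cancel₀ _ hq.ne']
  have hl : ∫ ω, min 1 (ρ ω / astar) ∂P = lam := by rw [hmin, hqa]; ring
  have hgap : (xstar - x_d) * (1 - q) = x_r - x_d := by
    rw [hxstar]; field_simp; ring
  have hle : x_d ≤ xstar := by
    by_contra! h
    nlinarith [mul_pos (sub_pos.2 h) hq]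
  have hbudget : ∫ ω, ρ ω * Xstar ω ∂P = x_r := by
    rw [hXbudget, eq_sub_of_add_eq' hsplit]; linarith
  have hrisk : (x_r - x_d) / astar = (xstar - x_d) * (lam - p) := by
    rw [← hgap, mul_div_assoc, hqa]
  have hval : -x_r + (1 / lam) * (xstar - x_d) * (p - lam * q) =
      (1 / lam) * (-(lam * x_d) - (x_r - x_d) / astar) := by
    rw [hrisk, show x_r = x_d + (xstar - x_d) * (1 - q) by linarith]
    field_simp
    ring
  have hdual (X : Ω → ℝ) (hX : Measurable X) (hdX : ∀ᵐ ω ∂P, x_d ≤ X ω)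
      (hρX : Integrable (fun ω => ρ ω * X ω) P) (hXr : ∫ ω, ρ ω * X ω ∂P = x_r) (t : ℝ) :
      -(lam * x_d) - (x_r - x_d) / astar ≤ (∫ ω, max (t - X ω) 0 ∂P) - lam * t := by
    simpa only [hXr] using
      le_integral_shortfall_sub_mul P hρpos hρint hρ1 hastar hl hX hdX hρX t
  have hdXstar : ∀ᵐ ω ∂P, x_d ≤ Xstar ω := .of_forall fun ω => by
    rw [hXstar]
    dsimp only
    split_ifs
    · exact le_rfl
    · exact hle
  have hlower (X : Ω → ℝ) (hX : Measurable X) (hdX : ∀ᵐ ω ∂P, x_d ≤ X ω)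
      (hρX : Integrable (fun ω => ρ ω * X ω) P) (hXr : ∫ ω, ρ ω * X ω ∂P = x_r) :
      -x_r + (1 / lam) * (xstar - x_d) * (p - lam * q) ≤ cvar P lam X := by
    rw [hval]
    exact mul_le_mul_of_nonneg_left (le_ciInf (hdual X hX hdX hρX hXr))
      (one_div_pos.2 hl0).le
  refine ⟨hlower, hbudget, le_antisymm ?_ (hlower Xstar hXmeas hdXstar hXint hbudget)⟩
  rw [hval]
  refine mul_le_mul_of_nonneg_left (ciInf_le_of_le ⟨_, Set.forall_mem_range.2
    (hdual Xstar hXmeas hdXstar hXint hbudget)⟩ xstar ?_) (one_div_pos.2 hl0).le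
  rw [hshort hle, hrisk]
  linarith
end

section
/- Let λ ∈ (0,1). Assume ρ has a continuous distribution (P(ρ = c) = 0 for every c ∈ ℝ) and P(ρ > 1/λ) > 0. Let ā > 0 satisfy E[ρ·X̄] = x_r for the Bar-System X̄ = x_d·1_{ρ>ā} + x_u·1_{ρ<ā}, set Ā = {ρ > ā}, and assume 1/ā ≤ (λ − P(Ā))/(1 − P̃(Ā)). Then for every measurable X with x_d ≤ X ≤ x_u almost surely and E[ρ·X] = x_r, one has CVaR_λ(X) ≥ CVaR_λ(X̄) = −x_r + (1/λ)·(x_u − x_d)·(P(Ā) − λ·P̃(Ā)). -/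
open MeasureTheory

/-- Lower bound for the expected shortfall below `t` of a portfolio `X ≥ x_d`, obtained from the
Lagrangian of the capital constraint with multiplier `1 / a`. -/
theorem shortfall_ge_lagrangian {Ω : Type*} [MeasurableSpace Ω] {P : Measure Ω}
    [IsProbabilityMeasure P] {ρ X : Ω → ℝ} (hρm : Measurable ρ) (hρpos : ∀ ω, 0 < ρ ω)
    (hρint : Integrable ρ P) (hρ1 : ∫ ω, ρ ω ∂P = 1) {x_d a : ℝ} (ha : 0 < a)
    (hX : Integrable X P) (hρX : Integrable (fun ω => ρ ω * X ω) P)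
    (hXd : ∀ᵐ ω ∂P, x_d ≤ X ω) (t : ℝ) :
    P.real {ω | a < ρ ω} * (t - x_d) + (∫ ω in {ω | a < ρ ω}, ρ ω ∂P) * ((x_d - t) / a)
      + t / a - (∫ ω, ρ ω * X ω ∂P) / a ≤ ∫ ω, max (t - X ω) 0 ∂P := by
  have hA : MeasurableSet {ω | a < ρ ω} := measurableSet_lt measurable_const hρm
  have h1 : Integrable ({ω | a < ρ ω}.indicator fun _ => (1 : ℝ)) P :=
    (integrable_const 1).indicator hA
  have h2 : Integrable ({ω | a < ρ ω}.indicator ρ) P := hρint.indicator hA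
  have h3 : Integrable (fun ω => {ω | a < ρ ω}.indicator (fun _ => (1 : ℝ)) ω * (t - x_d)
      + {ω | a < ρ ω}.indicator ρ ω * ((x_d - t) / a)) P := (h1.mul_const _).add (h2.mul_const _)
  have h4 : Integrable (fun ω => {ω | a < ρ ω}.indicator (fun _ => (1 : ℝ)) ω * (t - x_d)
      + {ω | a < ρ ω}.indicator ρ ω * ((x_d - t) / a) + ρ ω * (t / a)) P :=
    h3.add (hρint.mul_const _)
  have hI : ∫ ω, ({ω | a < ρ ω}.indicator (fun _ => (1 : ℝ)) ω * (t - x_d)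
      + {ω | a < ρ ω}.indicator ρ ω * ((x_d - t) / a) + ρ ω * (t / a)
      - ρ ω * X ω * (1 / a)) ∂P =
      P.real {ω | a < ρ ω} * (t - x_d) + (∫ ω in {ω | a < ρ ω}, ρ ω ∂P) * ((x_d - t) / a)
        + t / a - (∫ ω, ρ ω * X ω ∂P) / a := by
    rw [integral_sub h4 (hρX.mul_const _), integral_add h3 (hρint.mul_const _),
      integral_add (h1.mul_const _) (h2.mul_const _)]
    simp only [integral_mul_const, integral_indicator hA, hρ1, setIntegral_const, smul_eq_mul]
    ring
  rw [← hI]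
  refine integral_mono_ae (h4.sub (hρX.mul_const _)) ((integrable_const t).sub hX).pos_part ?_
  filter_upwards [hXd] with ω hω
  by_cases h : a < ρ ω
  · have h' : 1 ≤ ρ ω / a := (one_le_div ha).2 h.le
    simp only [Set.indicator, Set.mem_ofPred_eq, h, if_true]
    refine le_trans ?_ (le_max_left _ _)
    have : 1 * (t - x_d) + ρ ω * ((x_d - t) / a) + ρ ω * (t / a) - ρ ω * X ω * (1 / a)
        = t - x_d - ρ ω / a * (X ω - x_d) := by ring
    rw [this]
    nlinarith
  · have h' : ρ ω / a ≤ 1 := (div_le_one ha).2 (not_lt.1 h)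
    have h0 : 0 ≤ ρ ω / a := (div_pos (hρpos ω) ha).le
    simp only [Set.indicator, Set.mem_ofPred_eq, h, if_false]
    have : 0 * (t - x_d) + 0 * ((x_d - t) / a) + ρ ω * (t / a) - ρ ω * X ω * (1 / a)
        = ρ ω / a * (t - X ω) := by ring
    rw [this]
    exact (mul_le_mul_of_nonneg_left (le_max_left _ 0) h0).trans
      (mul_le_of_le_one_left (le_max_right _ _) h')

/-- Above an upper bound `b` of `X`, the shortfall functional of `CVaR_l` is nondecreasing. -/
theorem shortfall_sub_ge_of_le {Ω : Type*} [MeasurableSpace Ω] {P : Measure Ω}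
    [IsProbabilityMeasure P] {X : Ω → ℝ} (hX : Integrable X P) {b t l : ℝ}
    (hXb : ∀ᵐ ω ∂P, X ω ≤ b) (hl : l ≤ 1) (hbt : b ≤ t) :
    (∫ ω, max (b - X ω) 0 ∂P) - l * b ≤ (∫ ω, max (t - X ω) 0 ∂P) - l * t := by
  have hint : Integrable (fun ω => max (b - X ω) 0) P :=
    ((integrable_const b).sub hX).pos_part
  have h : ∫ ω, (max (b - X ω) 0 + (t - b)) ∂P ≤ ∫ ω, max (t - X ω) 0 ∂P := by
    refine integral_mono_ae (hint.add (integrable_const _))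
      ((integrable_const t).sub hX).pos_part ?_
    filter_upwards [hXb] with ω hω
    simp only [max_eq_left (sub_nonneg.2 hω)]
    exact le_trans (by linarith) (le_max_left _ _)
  rw [integral_add hint (integrable_const _), integral_const] at h
  simp only [probReal_univ, one_smul] at h
  nlinarith

/-- When `1/ā ≤ (λ − P(Ā))/(1 − P̃(Ā))`, the Bar-System
`X̄ = x_d·1_{ρ>ā} + x_u·1_{ρ<ā}` minimizes `CVaR_λ` over all portfolios bounded in
`[x_d, x_u]` with initial capital `x_r`, the minimal risk being
`−x_r + (1/λ)(x_u − x_d)(P(Ā) − λ·P̃(Ā))`. -/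
theorem bar_system_optimal_pure_cvar
    {Ω : Type*} [MeasurableSpace Ω] (P : Measure Ω) [IsProbabilityMeasure P]
    (ρ : Ω → ℝ) (hρm : Measurable ρ) (hρpos : ∀ ω, 0 < ρ ω)
    (hρint : Integrable ρ P) (hρ1 : ∫ ω, ρ ω ∂P = 1)
    (x_d x_r x_u : ℝ) (hdr : x_d < x_r) (hru : x_r < x_u)
    (lam : ℝ) (hlam : lam ∈ Set.Ioo (0 : ℝ) 1)
    (hcont : ∀ c : ℝ, P {ω | ρ ω = c} = 0)
    (htail : 0 < P {ω | 1 / lam < ρ ω})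
    (abar : ℝ) (habar : 0 < abar)
    (Xbar : Ω → ℝ)
    (hXbar : Xbar = fun ω => if abar < ρ ω then x_d else if ρ ω < abar then x_u else 0)
    (hcapbar : ∫ ω, ρ ω * Xbar ω ∂P = x_r)
    (hbarcase : 1 / abar ≤ (lam - (P {ω | abar < ρ ω}).toReal) /
        (1 - ∫ ω in {ω | abar < ρ ω}, ρ ω ∂P)) :
    (∀ X : Ω → ℝ, Measurable X → (∀ᵐ ω ∂P, x_d ≤ X ω ∧ X ω ≤ x_u) →
      (∫ ω, ρ ω * X ω ∂P = x_r) → cvar P lam Xbar ≤ cvar P lam X) ∧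
    cvar P lam Xbar = -x_r + (1 / lam) * (x_u - x_d) *
      ((P {ω | abar < ρ ω}).toReal - lam * ∫ ω in {ω | abar < ρ ω}, ρ ω ∂P) := by
  obtain ⟨hl0, hl1⟩ := hlam
  have hA : MeasurableSet {ω | abar < ρ ω} := measurableSet_lt measurable_const hρm
  have hXbar_ae : Xbar =ᵐ[P] fun ω =>
      x_u - {ω | abar < ρ ω}.indicator (fun _ => (1 : ℝ)) ω * (x_u - x_d) := by
    have hne : ∀ᵐ ω ∂P, ρ ω ≠ abar := by
      simpa [ae_iff] using hcont abar
    filter_upwards [hne] with ω hω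
    rcases lt_or_gt_of_ne hω with h | h
    · simp [hXbar, Set.indicator, h, h.not_gt]
    · simp [hXbar, Set.indicator, h]
  have hXbarm : Measurable Xbar := by
    rw [hXbar]
    exact Measurable.ite hA measurable_const
      (Measurable.ite (measurableSet_lt hρm measurable_const) measurable_const measurable_const)
  have hXbar_mem : ∀ᵐ ω ∂P, x_d ≤ Xbar ω ∧ Xbar ω ≤ x_u := by
    filter_upwards [hXbar_ae] with ω hω
    rw [hω]
    by_cases h : abar < ρ ω <;> simp [Set.indicator, h] <;> linarith
  have hcap : x_r = x_u - (∫ ω in {ω | abar < ρ ω}, ρ ω ∂P) * (x_u - x_d) := by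
    rw [← hcapbar]
    have : (fun ω => ρ ω * Xbar ω) =ᵐ[P] fun ω =>
        ρ ω * x_u - {ω | abar < ρ ω}.indicator ρ ω * (x_u - x_d) := by
      filter_upwards [hXbar_ae] with ω hω
      rw [hω]
      by_cases h : abar < ρ ω <;> simp [Set.indicator, h]
      ring
    rw [integral_congr_ae this,
      integral_sub (hρint.mul_const _) ((hρint.indicator hA).mul_const _)]
    simp only [integral_mul_const, integral_indicator hA, hρ1, one_mul]
  have hshort : ∫ ω, max (x_u - Xbar ω) 0 ∂P = P.real {ω | abar < ρ ω} * (x_u - x_d) := by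
    have : (fun ω => max (x_u - Xbar ω) 0) =ᵐ[P] fun ω =>
        {ω | abar < ρ ω}.indicator (fun _ => (1 : ℝ)) ω * (x_u - x_d) := by
      filter_upwards [hXbar_ae] with ω hω
      rw [hω]
      by_cases h : abar < ρ ω <;> simp [Set.indicator, h]
      linarith
    rw [integral_congr_ae this]
    simp [integral_mul_const, integral_indicator hA]
  change 1 / abar ≤ (lam - P.real {ω | abar < ρ ω}) / _ at hbarcase
  change _ ∧ cvar P lam Xbar =
    -x_r + (1 / lam) * (x_u - x_d) * (P.real {ω | abar < ρ ω} - lam * _)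
  set p := P.real {ω | abar < ρ ω}
  set q := ∫ ω in {ω | abar < ρ ω}, ρ ω ∂P
  have hq : 0 < 1 - q := by
    by_contra! h
    nlinarith
  have hpq : (1 - q) / abar ≤ lam - p := by
    rw [le_div_iff₀ hq] at hbarcase
    calc (1 - q) / abar = 1 / abar * (1 - q) := by ring
      _ ≤ lam - p := hbarcase
  have key : ∀ X : Ω → ℝ, Measurable X → (∀ᵐ ω ∂P, x_d ≤ X ω ∧ X ω ≤ x_u) →
      (∫ ω, ρ ω * X ω ∂P = x_r) → ∀ t : ℝ,
      p * (x_u - x_d) - lam * x_u ≤ (∫ ω, max (t - X ω) 0 ∂P) - lam * t := by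
    intro X hXm hXb hXr t
    have hbd : ∀ᵐ ω ∂P, ‖X ω‖ ≤ max |x_d| |x_u| := by
      filter_upwards [hXb] with ω hω
      exact abs_le_max_abs_abs hω.1 hω.2
    have hX : Integrable X P := .of_bound hXm.aestronglyMeasurable _ hbd
    have hρX : Integrable (fun ω => ρ ω * X ω) P :=
      hρint.mul_bdd hXm.aestronglyMeasurable hbd
    have hle : ∀ s ≤ x_u,
        p * (x_u - x_d) - lam * x_u ≤ (∫ ω, max (s - X ω) 0 ∂P) - lam * s := by
      intro s hs
      have h := shortfall_ge_lagrangian hρm hρpos hρint hρ1 habar hX hρX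
        (hXb.mono fun _ h => h.1) s
      rw [hXr, hcap] at h
      have e : p * (s - x_d) + q * ((x_d - s) / abar) + s / abar
          - (x_u - q * (x_u - x_d)) / abar
          = p * (s - x_d) - (1 - q) / abar * (x_u - s) := by ring
      have h' : p * (s - x_d) - (1 - q) / abar * (x_u - s) ≤ _ := e ▸ h
      nlinarith [mul_le_mul_of_nonneg_right hpq (sub_nonneg.2 hs)]
    rcases le_total t x_u with ht | ht
    · exact hle t ht
    · exact (hle x_u le_rfl).trans
        (shortfall_sub_ge_of_le hX (hXb.mono fun _ h => h.2) hl1.le ht)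
  have hval : cvar P lam Xbar = (1 / lam) * (p * (x_u - x_d) - lam * x_u) := by
    have hk := key Xbar hXbarm hXbar_mem hcapbar
    unfold cvar
    congr 1
    refine le_antisymm ?_ (le_ciInf hk)
    refine (ciInf_le ⟨_, Set.forall_mem_range.2 hk⟩ x_u).trans_eq ?_
    rw [hshort]
  refine ⟨fun X hXm hXb hXr => ?_, ?_⟩
  · rw [hval]
    exact mul_le_mul_of_nonneg_left (le_ciInf (key X hXm hXb hXr)) (by positivity)
  · rw [hval, hcap]
    field_simp
    ring
end

section
/- Let λ ∈ (0,1), let a* > 0, set A* = {ρ > a*} and B* = {ρ ≤ a*}, and assume P(A*) < λ and P̃(A*) < 1. Define x* = (x_r − x_d·P̃(A*))/(1 − P̃(A*)) and z* = x_d·P(A*) + x*·P(B*). Let z > z*, set γ = z − z*, let ε > 0, and set δ = λ·ε/(λ − P(A*)); assume δ ≤ x* − x_d. Suppose b ∈ (0, a*) satisfies P(ρ < b) > 0 and E[ρ·1_{ρ<b}] / P(ρ < b) = P̃(B*)/( γ/δ + P(B*) ). Define α = x* + ( P̃(B*)/P̃(ρ < b) − 1 )·δ and the three-line portfolio X = x_d·1_{ρ>a*}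 + (x* − δ)·1_{b≤ρ≤a*} + α·1_{ρ<b}. Then X ≥ x_d almost surely, E[ρ·X] = x_r, E[X] = z, and CVaR_λ(X) ≤ −x_r + (1/λ)·(x* − x_d)·(P(A*) − λ·P̃(A*)) + ε. (Thus with no upper bound on the portfolio, a three-line configuration meeting both constraints brings the CVaR within ε of the infimal value.) -/
open MeasureTheory

lemma integrable_indicator_step {Ω : Type*} [MeasurableSpace Ω] {P : Measure Ω} {f : Ω → ℝ}
    (hf : Integrable f P) {A D : Set Ω} (hA : MeasurableSet A) (hD : MeasurableSet D)
    (c u v : ℝ) :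
    Integrable (fun ω => c * f ω + u * A.indicator f ω + v * D.indicator f ω) P :=
  ((hf.const_mul c).add ((hf.indicator hA).const_mul u)).add ((hf.indicator hD).const_mul v)

lemma integral_indicator_step {Ω : Type*} [MeasurableSpace Ω] {P : Measure Ω} {f : Ω → ℝ}
    (hf : Integrable f P) {A D : Set Ω} (hA : MeasurableSet A) (hD : MeasurableSet D)
    (c u v : ℝ) :
    ∫ ω, (c * f ω + u * A.indicator f ω + v * D.indicator f ω) ∂P =
      c * ∫ ω, f ω ∂P + u * ∫ ω in A, f ω ∂P + v * ∫ ω in D, f ω ∂P := by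
  have hc := hf.const_mul c
  have hu := (hf.indicator hA).const_mul u
  have hcu : Integrable (fun ω => c * f ω + u * A.indicator f ω) P := hc.add hu
  have hv := (hf.indicator hD).const_mul v
  rw [integral_add hcu hv, integral_add hc hu]
  simp only [integral_const_mul, integral_indicator hA, integral_indicator hD]

/-- Every shortfall level `t` gives an upper bound on `cvar`. -/
lemma cvar_le {Ω : Type*} [MeasurableSpace Ω] {P : Measure Ω} [IsProbabilityMeasure P]
    {l : ℝ} (hl : l ∈ Set.Ioo (0 : ℝ) 1) {X : Ω → ℝ} (hX : Integrable X P) (t : ℝ) :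
    cvar P l X ≤ (1 / l) * ((∫ ω, max (t - X ω) 0 ∂P) - l * t) := by
  refine mul_le_mul_of_nonneg_left (ciInf_le ⟨-(l * ∫ ω, X ω ∂P), ?_⟩ t)
    (one_div_nonneg.2 hl.1.le)
  rintro _ ⟨s, rfl⟩
  have hs : Integrable (fun ω => s - X ω) P := (integrable_const s).sub hX
  have h : ∫ ω, l * (s - X ω) ∂P ≤ ∫ ω, max (s - X ω) 0 ∂P := by
    refine integral_mono (hs.const_mul l) hs.pos_part fun ω => ?_
    rcases le_total 0 (s - X ω) with h0 | h0
    · exact (mul_le_of_le_one_left h0 hl.2.le).trans (le_max_left _ _)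
    · exact (mul_nonpos_of_nonneg_of_nonpos hl.1.le h0).trans (le_max_right _ _)
  rw [integral_const_mul, integral_sub (integrable_const s) hX] at h
  simp only [integral_const, probReal_univ, one_smul] at h
  dsimp only
  linarith

/-- With no upper bound on the portfolio, the three-line configuration
`X = x_d·1_{ρ>a*} + (x* − δ)·1_{b≤ρ≤a*} + α·1_{ρ<b}` meets both the capital and return
constraints and brings the CVaR within `ε` of the infimal value
`−x_r + (1/λ)(x* − x_d)(P(A*) − λ·P̃(A*))`. -/
theorem three_line_epsilon_suboptimal_unbounded
    {Ω : Type*} [MeasurableSpace Ω] (P : Measure Ω) [IsProbabilityMeasure P]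
    (ρ : Ω → ℝ) (hρm : Measurable ρ) (hρpos : ∀ ω, 0 < ρ ω)
    (hρint : Integrable ρ P) (hρ1 : ∫ ω, ρ ω ∂P = 1)
    (x_d x_r : ℝ) (hdr : x_d < x_r)
    (lam : ℝ) (hlam : lam ∈ Set.Ioo (0 : ℝ) 1)
    (astar : ℝ) (hastar : 0 < astar)
    (hPA : (P {ω | astar < ρ ω}).toReal < lam)
    (hPtA : (∫ ω in {ω | astar < ρ ω}, ρ ω ∂P) < 1)
    (xstar zstar : ℝ)
    (hxstar : xstar = (x_r - x_d * ∫ ω in {ω | astar < ρ ω}, ρ ω ∂P) /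
        (1 - ∫ ω in {ω | astar < ρ ω}, ρ ω ∂P))
    (hzstar : zstar = x_d * (P {ω | astar < ρ ω}).toReal +
        xstar * (P {ω | ρ ω ≤ astar}).toReal)
    (z γ ε δ : ℝ) (hz : zstar < z) (hγ : γ = z - zstar) (hε : 0 < ε)
    (hδ : δ = lam * ε / (lam - (P {ω | astar < ρ ω}).toReal))
    (hδle : δ ≤ xstar - x_d)
    (b : ℝ) (hb : 0 < b) (hba : b < astar)
    (hPD : 0 < P {ω | ρ ω < b})
    (hratio : (∫ ω in {ω | ρ ω < b}, ρ ω ∂P) / (P {ω | ρ ω < b}).toReal =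
        (∫ ω in {ω | ρ ω ≤ astar}, ρ ω ∂P) / (γ / δ + (P {ω | ρ ω ≤ astar}).toReal))
    (α : ℝ)
    (hα : α = xstar +
        ((∫ ω in {ω | ρ ω ≤ astar}, ρ ω ∂P) / (∫ ω in {ω | ρ ω < b}, ρ ω ∂P) - 1) * δ)
    (X : Ω → ℝ)
    (hX : X = fun ω => if astar < ρ ω then x_d else if ρ ω < b then α else xstar - δ) :
    (∀ᵐ ω ∂P, x_d ≤ X ω) ∧
    (∫ ω, ρ ω * X ω ∂P = x_r) ∧
    (∫ ω, X ω ∂P = z) ∧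
    cvar P lam X ≤ -x_r + (1 / lam) * (xstar - x_d) *
      ((P {ω | astar < ρ ω}).toReal - lam * ∫ ω in {ω | astar < ρ ω}, ρ ω ∂P) + ε := by
  set A : Set Ω := {ω | astar < ρ ω} with hAdef
  set D : Set Ω := {ω | ρ ω < b} with hDdef
  have hA : MeasurableSet A := measurableSet_lt measurable_const hρm
  have hD : MeasurableSet D := measurableSet_lt hρm measurable_const
  have hB : {ω | ρ ω ≤ astar} = Aᶜ := by ext; simp [hAdef]
  have hpB : (P Aᶜ).toReal = 1 - (P A).toReal := probReal_compl_eq_one_sub hA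
  have hqB : ∫ ω in Aᶜ, ρ ω ∂P = 1 - ∫ ω in A, ρ ω ∂P := by
    rw [setIntegral_compl hA hρint, hρ1]
  have hd : 0 < (P D).toReal := ENNReal.toReal_pos hPD.ne' (measure_ne_top P D)
  have hqd : 0 < ∫ ω in D, ρ ω ∂P := by
    rw [setIntegral_pos_iff_support_of_nonneg_ae (ae_of_all _ fun ω => (hρpos ω).le)
      hρint.integrableOn]
    have : Function.support ρ = Set.univ := Set.eq_univ_of_forall fun ω => (hρpos ω).ne'
    rwa [this, Set.univ_inter]
  rw [hB, hpB] at hzstar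
  rw [hB, hpB, hqB] at hratio
  rw [hB, hqB] at hα
  have hA1 : ∫ _ in A, (1 : ℝ) ∂P = (P A).toReal := by simp [Measure.real]
  have hD1 : ∫ _ in D, (1 : ℝ) ∂P = (P D).toReal := by simp [Measure.real]
  generalize hq : ∫ ω in A, ρ ω ∂P = q at *
  generalize hqd' : ∫ ω in D, ρ ω ∂P = r at *
  generalize hp : (P A).toReal = p at *
  generalize hd' : (P D).toReal = d at *
  have hl0 := hlam.1
  have hδ0 : 0 < δ := by
    rw [hδ]; exact div_pos (mul_pos hl0 hε) (sub_pos.2 hPA)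
  have hq1 : 0 < 1 - q := sub_pos.2 hPtA
  have hgap : α - (xstar - δ) = (1 - q) / r * δ := by rw [hα]; ring
  have hgap0 : 0 < α - (xstar - δ) := by rw [hgap]; positivity
  have hbudget : xstar * (1 - q) = x_r - x_d * q := by
    rw [hxstar, div_mul_cancel₀ _ hq1.ne']
  have hreturn : (1 - q) / r * δ * d = γ + (1 - p) * δ := by
    have hden : γ / δ + (1 - p) ≠ 0 := by
      intro h0
      rw [h0, div_zero] at hratio
      exact (div_pos hqd hd).ne' hratio
    rw [div_eq_div_iff hd.ne' hden] at hratio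
    field_simp at hratio ⊢
    linarith
  have hXstep : ∀ ω, X ω = (xstar - δ) * 1 +
      (x_d - (xstar - δ)) * A.indicator (fun _ => (1 : ℝ)) ω +
      (α - (xstar - δ)) * D.indicator (fun _ => (1 : ℝ)) ω := by
    intro ω
    by_cases h1 : astar < ρ ω
    · have h2 : ¬ ρ ω < b := by linarith
      simp [hX, hAdef, hDdef, h1, h2]
    · by_cases h2 : ρ ω < b <;> simp [hX, hAdef, hDdef, h1, h2]
  have hone : Integrable (fun _ : Ω => (1 : ℝ)) P := integrable_const 1
  have hXint : Integrable X P := by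
    rw [funext hXstep]
    exact integrable_indicator_step hone hA hD _ _ _
  refine ⟨ae_of_all _ fun ω => ?_, ?_, ?_, ?_⟩
  · simp only [hX]
    split_ifs <;> linarith
  · have hρX : ∀ ω, ρ ω * X ω = (xstar - δ) * ρ ω +
        (x_d - (xstar - δ)) * A.indicator ρ ω + (α - (xstar - δ)) * D.indicator ρ ω := by
      intro ω
      rw [hXstep]
      by_cases h1 : ω ∈ A <;> by_cases h2 : ω ∈ D <;> simp [h1, h2] <;> ring
    simp only [hρX]
    rw [integral_indicator_step hρint hA hD, hρ1, hq, hqd', hgap]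
    have : (1 - q) / r * δ * r = (1 - q) * δ := by field_simp
    linarith
  · simp only [hXstep]
    rw [integral_indicator_step hone hA hD, hA1, hD1, hgap, hreturn]
    simp only [integral_const, probReal_univ, one_smul]
    linarith
  · refine (cvar_le hlam hXint (xstar - δ)).trans (le_of_eq ?_)
    have hmax : ∀ ω, max (xstar - δ - X ω) 0 =
        A.indicator (fun _ => xstar - δ - x_d) ω := by
      intro ω
      by_cases h1 : astar < ρ ω
      · simpa [hX, hAdef, h1] using le_sub_comm.1 hδle
      · by_cases h2 : ρ ω < b
        · simp only [hX, hAdef, h1, h2, if_true, if_false, Set.indicator, Set.mem_ofPred_eq]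
          exact max_eq_right (by linarith)
        · simp [hX, hAdef, h1, h2]
    simp only [hmax]
    rw [integral_indicator hA, setIntegral_const, smul_eq_mul, Measure.real, hp]
    have hδε : δ * (lam - p) = lam * ε := by
      rw [hδ, div_mul_cancel₀ _ (sub_pos.2 hPA).ne']
    field_simp
    linear_combination hδε - lam * hbudget
end

section
/- Let λ ∈ (0,1). Assume ρ ≤ 1/λ almost surely and P(ρ = 1/λ) = 0, and let z > x_r. Then no feasible portfolio attains the infimal risk −x_r: every integrable measurable random variable X with X ≥ x_d almost surely, E[ρ·X] = x_r and E[X] ≥ z satisfies CVaR_λ(X) > −x_r. (Together with the lower bound CVaR_λ(X) ≥ −x_r, this shows the Mean-CVaR problem has infimum −x_r but no optimal solution when the return requirement exceeds x_r.) -/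
open MeasureTheory

/-- The convex function of the threshold `t` minimized in `cvar` attains its infimum. -/
theorem exists_forall_cvar_objective_le {Ω : Type*} [MeasurableSpace Ω] (P : Measure Ω)
    [IsProbabilityMeasure P] {l : ℝ} (hl : l ∈ Set.Ioo (0 : ℝ) 1) {X : Ω → ℝ}
    (hX : Integrable X P) :
    ∃ s : ℝ, ∀ t : ℝ,
      (∫ ω, max (s - X ω) 0 ∂P) - l * s ≤ (∫ ω, max (t - X ω) 0 ∂P) - l * t := by
  have hpart (t : ℝ) : Integrable (fun ω => max (t - X ω) 0) P :=
    ((integrable_const t).sub hX).pos_part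
  have hlip : LipschitzWith 1 (fun t : ℝ => ∫ ω, max (t - X ω) 0 ∂P) := by
    refine LipschitzWith.of_le_add fun s t => ?_
    have h : ∫ ω, max (s - X ω) 0 ∂P ≤ ∫ ω, (max (t - X ω) 0 + dist s t) ∂P := by
      refine integral_mono (hpart s) ((hpart t).add (integrable_const _)) fun ω => ?_
      have h1 : s - t ≤ dist s t := le_abs_self _
      have h2 : 0 ≤ dist s t := dist_nonneg
      refine max_le ?_ ?_
      · linarith [le_max_left (t - X ω) 0]
      · linarith [le_max_right (t - X ω) 0]
    rwa [integral_add (hpart t) (integrable_const _), integral_const, probReal_univ,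
      one_smul] at h
  refine Continuous.exists_forall_le (hlip.continuous.sub (continuous_const.mul continuous_id)) ?_
  rw [cocompact_eq_atBot_atTop, Filter.tendsto_sup]
  constructor
  · refine Filter.tendsto_atTop_mono (f := fun t : ℝ => -l * t) (fun t => ?_)
      (Filter.tendsto_id.const_mul_atBot_of_neg (neg_lt_zero.2 hl.1))
    have h : 0 ≤ ∫ ω, max (t - X ω) 0 ∂P := integral_nonneg fun ω => le_max_right _ _
    linarith
  · refine Filter.tendsto_atTop_mono (f := fun t : ℝ => (1 - l) * t + -∫ ω, X ω ∂P) (fun t => ?_)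
      (Filter.tendsto_atTop_add_const_right _ _
        (Filter.tendsto_id.const_mul_atTop (sub_pos.2 hl.2)))
    have h : ∫ ω, (t - X ω) ∂P ≤ ∫ ω, max (t - X ω) 0 ∂P :=
      integral_mono ((integrable_const t).sub hX) (hpart t) fun ω => le_max_left _ _
    rw [integral_sub (integrable_const t) hX, integral_const, probReal_univ, one_smul] at h
    linarith

/-- If the density `ρ` stays strictly between `0` and `1/l` and `X` is not almost surely equal to
`t`, the objective in `cvar` at the threshold `t` exceeds `-l · E[ρ X]`. -/
theorem neg_mul_integral_lt_cvar_objective {Ω : Type*} [MeasurableSpace Ω] (P : Measure Ω)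
    [IsProbabilityMeasure P] {l : ℝ} (hl : 0 < l) {ρ X : Ω → ℝ} (hρpos : ∀ ω, 0 < ρ ω)
    (hρint : Integrable ρ P) (hρ1 : ∫ ω, ρ ω ∂P = 1) (hρlt : ∀ᵐ ω ∂P, l * ρ ω < 1)
    (hX : Integrable X P) (hρX : Integrable (fun ω => ρ ω * X ω) P) (t : ℝ)
    (hne : ¬ ∀ᵐ ω ∂P, X ω = t) :
    -(l * ∫ ω, ρ ω * X ω ∂P) < (∫ ω, max (t - X ω) 0 ∂P) - l * t := by
  have hmax : Integrable (fun ω => max (t - X ω) 0) P :=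
    ((integrable_const t).sub hX).pos_part
  have hlin : Integrable (fun ω => l * (t * ρ ω - ρ ω * X ω)) P :=
    ((hρint.const_mul t).sub hρX).const_mul l
  have hgap : ∫ ω, (max (t - X ω) 0 - l * (t * ρ ω - ρ ω * X ω)) ∂P =
      (∫ ω, max (t - X ω) 0 ∂P) - l * t + l * ∫ ω, ρ ω * X ω ∂P := by
    rw [integral_sub hmax hlin, integral_const_mul, integral_sub (hρint.const_mul t) hρX,
      integral_const_mul, hρ1]
    ring
  have hnonneg : 0 ≤ᵐ[P] fun ω => max (t - X ω) 0 - l * (t * ρ ω - ρ ω * X ω) := by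
    filter_upwards [hρlt] with ω hω
    have hpos := mul_pos hl (hρpos ω)
    simp only [Pi.zero_apply]
    rcases le_total (X ω) t with h | h
    · rw [max_eq_left (by linarith)]
      nlinarith
    · rw [max_eq_right (by linarith)]
      nlinarith
  by_contra! hle
  refine hne ?_
  have hzero := (integral_eq_zero_iff_of_nonneg_ae hnonneg (hmax.sub hlin)).1
    (le_antisymm (by rw [hgap]; linarith) (integral_nonneg_of_ae hnonneg))
  filter_upwards [hρlt, hzero] with ω hω h0
  have hpos := mul_pos hl (hρpos ω)
  simp only [Pi.zero_apply] at h0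
  rcases lt_trichotomy (X ω) t with h | h | h
  · rw [max_eq_left (by linarith)] at h0
    nlinarith
  · exact h
  · rw [max_eq_right (by linarith)] at h0
    nlinarith

/-- If `ρ ≤ 1/λ` a.s. with `P(ρ = 1/λ) = 0` and the required return `z` exceeds `x_r`,
then no feasible portfolio attains the infimal risk `−x_r`: every feasible portfolio has
`CVaR_λ` strictly greater than `−x_r`. -/
theorem mean_cvar_no_optimal_solution
    {Ω : Type*} [MeasurableSpace Ω] (P : Measure Ω) [IsProbabilityMeasure P]
    (ρ : Ω → ℝ) (hρm : Measurable ρ) (hρpos : ∀ ω, 0 < ρ ω)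
    (hρint : Integrable ρ P) (hρ1 : ∫ ω, ρ ω ∂P = 1)
    (x_d x_r : ℝ) (hdr : x_d < x_r)
    (lam : ℝ) (hlam : lam ∈ Set.Ioo (0 : ℝ) 1)
    (hρle : ∀ᵐ ω ∂P, ρ ω ≤ 1 / lam)
    (hnull : P {ω | ρ ω = 1 / lam} = 0)
    (z : ℝ) (hz : x_r < z) :
    ∀ X : Ω → ℝ, Measurable X → Integrable X P → (∀ᵐ ω ∂P, x_d ≤ X ω) →
      Integrable (fun ω => ρ ω * X ω) P → (∫ ω, ρ ω * X ω ∂P = x_r) →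
      z ≤ ∫ ω, X ω ∂P →
      -x_r < cvar P lam X := by
  intro X _ hX _ hρX hxr hzX
  have hl := hlam.1
  have hρlt : ∀ᵐ ω ∂P, lam * ρ ω < 1 := by
    have hne : ∀ᵐ ω ∂P, ρ ω ≠ 1 / lam := by
      rw [ae_iff]
      simpa using hnull
    filter_upwards [hρle, hne] with ω h1 h2
    rw [mul_comm]
    exact (lt_div_iff₀ hl).1 (lt_of_le_of_ne h1 h2)
  obtain ⟨s, hs⟩ := exists_forall_cvar_objective_le P hlam hX
  have hlt := neg_mul_integral_lt_cvar_objective P hl hρpos hρint hρ1 hρlt hX hρX s fun hconst => by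
    have hmean : ∫ ω, X ω ∂P = s := by
      rw [integral_congr_ae hconst, integral_const, probReal_univ, one_smul]
    have hprice : ∫ ω, ρ ω * X ω ∂P = s := by
      rw [integral_congr_ae (g := fun ω => ρ ω * s) (hconst.mono fun ω h => by simp only [h]),
        integral_mul_const, hρ1, one_mul]
    linarith
  rw [hxr] at hlt
  rw [cvar, one_div_mul_eq_div, lt_div_iff₀ hl]
  linarith [le_ciInf hs]
end
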